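/- arXiv:2008.00677 — 2 statements merged into one kernel-verified Lean document; each statement's English description precedes it below -/
import Mathlib

section
/- There exist constants c > 0 and C > 0 such that the following holds. Let u be harmonic on an open subset of ℝ² containing the closed disk of radius 2 centered at 0, and suppose u is not identically zero on the disk B(0,2). Let N = log( sup_{B(0,2)} |u| / sup_{B(0,1)} |u| ). Then every connected component of {x ∈ B(0,2) : u(x) ≠ 0} that intersects B(0,1) has Lebesgue measure at least c/(N + C). -/
open MeasureTheory Metric Set

/-- The Euclidean Laplacian `Δu = ∑ⱼ ∂²u/∂xⱼ²` of `u : ℝⁿ → ℝ`. -/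
noncomputable def lapl (n : ℕ) (u : EuclideanSpace ℝ (Fin n) → ℝ)
    (x : EuclideanSpace ℝ (Fin n)) : ℝ :=
  ∑ j : Fin n,
    fderiv ℝ (fun y => fderiv ℝ u y (EuclideanSpace.single j (1:ℝ))) x
      (EuclideanSpace.single j (1:ℝ))

open InnerProductSpace in
/-- Every continuous function on a circle is uniformly approximated by the restriction of an entire
harmonic function. -/
lemma exists_harmonic_near_on_sphere {φ : ℂ → ℝ} {c : ℂ} {s ε : ℝ} (hs : 0 < s) (hε : 0 < ε)
    (hφ : ContinuousOn φ (sphere c s)) :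
    ∃ H : ℂ → ℝ, (∀ x, HarmonicAt H x) ∧ ∀ x ∈ sphere c s, |H x - φ x| ≤ ε := by
  have : Fact (0 < 2 * Real.pi) := ⟨Real.two_pi_pos⟩
  have hs0 : (s : ℂ) ≠ 0 := by exact_mod_cast hs.ne'
  have hspan : ∀ p ∈ Submodule.span ℂ (range (@fourier (2 * Real.pi))),
      ∃ H : ℂ → ℂ, (∀ x, HarmonicAt H x) ∧ ∀ θ : ℝ, H (circleMap c s θ) = p θ := by
    intro p hp
    induction hp using Submodule.span_induction with
    | mem p hp =>
      obtain ⟨n, rfl⟩ := hp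
      have key : ∀ (m : ℕ) (θ : ℝ), ((circleMap c s θ - c) / s) ^ m
          = Complex.exp (m * θ * Complex.I) := by
        intro m θ
        rw [circleMap, add_sub_cancel_left, mul_div_cancel_left₀ _ hs0, ← Complex.exp_nat_mul]
        congr 1; ring
      have hpi : (Real.pi : ℂ) ≠ 0 := by exact_mod_cast Real.pi_ne_zero
      have han : ∀ (m : ℕ) x, AnalyticAt ℂ (fun z : ℂ => ((z - c) / s) ^ m) x := by
        intro m x
        apply Differentiable.analyticAt
        fun_prop
      rcases Int.eq_nat_or_neg n with ⟨m, rfl | rfl⟩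
      · refine ⟨fun z => ((z - c) / s) ^ m, fun x => (han m x).harmonicAt, fun θ => ?_⟩
        simp only [key, fourier_coe_apply]
        congr 1
        push_cast
        field_simp
      · refine ⟨fun z => (starRingEnd ℂ) (((z - c) / s) ^ m),
          fun x => (han m x).harmonicAt_conj, fun θ => ?_⟩
        simp only [key, fourier_coe_apply, ← Complex.exp_conj]
        congr 1
        simp
        field_simp
    | zero => exact ⟨fun _ => 0, fun x => by simp, by simp⟩
    | add p q _ _ hp hq =>
      obtain ⟨H, h1, h2⟩ := hp
      obtain ⟨K, k1, k2⟩ := hq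
      exact ⟨H + K, fun x => (h1 x).add (k1 x), fun θ => by simp [h2, k2]⟩
    | smul a p _ hp =>
      obtain ⟨H, h1, h2⟩ := hp
      exact ⟨_, fun x => (h1 x).comp_CLM ((ContinuousLinearMap.mul ℂ ℂ a).restrictScalars ℝ),
        fun θ => by simp [h2]⟩
  have hper : Function.Periodic (fun θ : ℝ => ((φ (circleMap c s θ) : ℝ) : ℂ)) (2 * Real.pi) := by
    intro θ
    simp [periodic_circleMap c s θ]
  have hcont : Continuous hper.lift := by
    apply continuous_coinduced_dom.mpr
    have : ContinuousOn (φ ∘ circleMap c s) univ := hφ.comp (by fun_prop)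
      (fun θ _ => circleMap_mem_sphere c hs.le θ)
    have h2 : Continuous fun θ => φ (circleMap c s θ) := by
      rwa [continuousOn_univ] at this
    exact Complex.continuous_ofReal.comp h2
  set P : C(AddCircle (2 * Real.pi), ℂ) := ⟨hper.lift, hcont⟩ with hP
  have hmem : P ∈ (Submodule.span ℂ (range (@fourier (2 * Real.pi)))).topologicalClosure := by
    rw [span_fourier_closure_eq_top]; trivial
  obtain ⟨p, hp, hd⟩ := Metric.mem_closure_iff.1 hmem ε hε
  obtain ⟨H, h1, h2⟩ := hspan p hp
  refine ⟨_, fun x => (h1 x).comp_CLM Complex.reCLM, fun x hx => ?_⟩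
  obtain ⟨θ, rfl⟩ : ∃ θ : ℝ, circleMap c s θ = x := by
    have : x ∈ range (circleMap c s) := by rw [range_circleMap, abs_of_pos hs]; exact hx
    exact this
  have h3 := (ContinuousMap.dist_apply_le_dist (f := P) (g := p) (θ : AddCircle (2 * Real.pi)))
  have h4 : P (θ : AddCircle (2 * Real.pi)) = (φ (circleMap c s θ) : ℂ) := rfl
  rw [h4, ← h2 θ, dist_comm, dist_eq_norm] at h3
  have h5 := Complex.abs_re_le_norm (H (circleMap c s θ) - (φ (circleMap c s θ) : ℂ))
  simp only [Complex.sub_re, Complex.ofReal_re] at h5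
  simpa using h5.trans (h3.trans hd.le)

/-- Maximum principle for functions satisfying the local sub-mean value inequality. -/
lemma le_of_local_submean {f : ℂ → ℝ} {c : ℂ} {s B : ℝ}
    (hf : ContinuousOn f (closedBall c s))
    (hsub : ∀ x ∈ ball c s, ∃ ε > 0, ∀ r ∈ Ioo 0 ε, f x ≤ Real.circleAverage f x r)
    (hB : ∀ x ∈ sphere c s, f x ≤ B) : ∀ x ∈ closedBall c s, f x ≤ B := by
  intro x₀ hx₀
  obtain ⟨x, hx, hmax⟩ := (isCompact_closedBall c s).exists_isMaxOn ⟨x₀, hx₀⟩ hf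
  by_contra! hlt
  have hxB : B < f x := hlt.trans_le (hmax hx₀)
  have hKc : IsCompact (closedBall c s ∩ f ⁻¹' {f x}) :=
    (isCompact_closedBall c s).of_isClosed_subset
      (hf.preimage_isClosed_of_isClosed isClosed_closedBall isClosed_singleton) inter_subset_left
  obtain ⟨y, ⟨hy, hyx⟩, hfar⟩ := hKc.exists_isMaxOn ⟨x, hx, rfl⟩
    (continuous_id.dist (continuous_const (y := c))).continuousOn
  have hyx' : f y = f x := hyx
  have hyb : dist y c < s := by
    refine lt_of_le_of_ne hy fun h => ?_
    have := hB y h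
    linarith
  obtain ⟨ε, hε, hav⟩ := hsub y hyb
  obtain ⟨r, hr0, hr⟩ := exists_between (lt_min hε (sub_pos.2 hyb))
  have hr1 := hr.trans_le (min_le_left _ _)
  have hr2 := hr.trans_le (min_le_right _ _)
  have hsph : sphere y r ⊆ closedBall c s := by
    intro z hz
    have h1 := dist_triangle z y c
    rw [mem_sphere] at hz
    rw [mem_closedBall]; linarith
  have hcont : Continuous fun θ => f (circleMap y r θ) := by
    rw [← continuousOn_univ]
    exact (hf.mono hsph).comp (by fun_prop) fun θ _ => circleMap_mem_sphere y hr0.le θ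
  have hle : ∀ θ, f (circleMap y r θ) ≤ f y := fun θ => by
    rw [hyx']; exact hmax (hsph (circleMap_mem_sphere y hr0.le θ))
  have heq : ∀ θ ∈ Icc 0 (2 * Real.pi), f (circleMap y r θ) = f y := by
    intro θ hθ
    by_contra hne
    have hlt := intervalIntegral.integral_lt_integral_of_continuousOn_of_le_of_exists_lt
      Real.two_pi_pos hcont.continuousOn (continuousOn_const (c := f y))
      (fun θ _ => hle θ) ⟨θ, hθ, lt_of_le_of_ne (hle θ) hne⟩
    have h1 := hav r ⟨hr0, hr1⟩
    rw [Real.circleAverage_def, smul_eq_mul] at h1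
    rw [intervalIntegral.integral_const, sub_zero, smul_eq_mul] at hlt
    have := mul_lt_mul_of_pos_left hlt (inv_pos.2 Real.two_pi_pos)
    rw [inv_mul_cancel_left₀ Real.two_pi_pos.ne'] at this
    linarith
  obtain ⟨z, hz, hzfar⟩ : ∃ z ∈ sphere y r, dist y c < dist z c := by
    by_cases hyc : y = c
    · subst hyc
      exact ⟨circleMap y r 0, circleMap_mem_sphere y hr0.le 0, by simp [hr0.ne']⟩
    · have hpos : 0 < ‖y - c‖ := norm_pos_iff.2 (sub_ne_zero.2 hyc)
      refine ⟨y + (r / ‖y - c‖ : ℝ) • (y - c), ?_, ?_⟩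
      · rw [mem_sphere, dist_eq_norm, add_sub_cancel_left, norm_smul, Real.norm_of_nonneg
          (by positivity), div_mul_cancel₀ _ hpos.ne']
      · have : y + (r / ‖y - c‖ : ℝ) • (y - c) - c = (1 + r / ‖y - c‖ : ℝ) • (y - c) := by
          rw [add_smul, one_smul]; ring
        rw [dist_eq_norm, dist_eq_norm, this, norm_smul, Real.norm_of_nonneg (by positivity)]
        have : 0 < r / ‖y - c‖ := by positivity
        nlinarith
  have hzr : z ∈ circleMap y r '' Ioc 0 (2 * Real.pi) := by
    rw [image_circleMap_Ioc, abs_of_pos hr0]; exact hz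
  obtain ⟨θ, hθ, rfl⟩ := hzr
  have := hfar ⟨hsph hz, by
    show f _ = f x
    rw [heq θ ⟨hθ.1.le, hθ.2⟩, hyx']⟩
  exact absurd hzfar (not_lt.2 this)

open InnerProductSpace in
/-- A nonnegative continuous function on `U` that is harmonic near every point where it does not
vanish, such as the absolute value of a harmonic function cut off to one of its nodal domains. -/
structure IsNodal (w : ℂ → ℝ) (U : Set ℂ) : Prop where
  continuousOn : ContinuousOn w U
  nonneg : ∀ x, 0 ≤ w x
  harmonicAt : ∀ x ∈ U, w x ≠ 0 → HarmonicAt w x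

namespace IsNodal

variable {w : ℂ → ℝ} {U : Set ℂ}

open InnerProductSpace in
lemma local_submean_sub (hw : IsNodal w U) (hU : IsOpen U) {H : ℂ → ℝ}
    (hH : ∀ x, HarmonicAt H x) {x : ℂ} (hx : x ∈ U) :
    ∃ ε > 0, ∀ r ∈ Ioo 0 ε, (w - H) x ≤ Real.circleAverage (w - H) x r := by
  have hHc : Continuous H := continuous_iff_continuousAt.2 fun y => (hH y).1.continuousAt
  by_cases h0 : w x = 0
  · obtain ⟨ε, hε, hb⟩ := Metric.isOpen_iff.1 hU x hx
    refine ⟨ε, hε, fun r hr => ?_⟩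
    have hs : sphere x |r| ⊆ U := by
      rw [abs_of_pos hr.1]
      exact (sphere_subset_closedBall.trans (closedBall_subset_ball hr.2)).trans hb
    have h1 : CircleIntegrable w x r := (hw.continuousOn.mono hs).circleIntegrable'
    have h2 : CircleIntegrable H x r := hHc.continuousOn.circleIntegrable'
    rw [Real.circleAverage_sub h1 h2,
      InnerProductSpace.HarmonicOnNhd.circleAverage_eq (fun y _ => hH y),
      Pi.sub_apply, h0]
    have := Real.circleAverage_nonneg_of_nonneg (c := x) (R := r) (f := w) fun y _ => hw.nonneg y
    linarith
  · have h1 := ((hw.harmonicAt x hx h0).sub (hH x)).eventually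
    obtain ⟨ε, hε, hb⟩ := Metric.eventually_nhds_iff_ball.1 h1
    refine ⟨ε, hε, fun r hr => ?_⟩
    rw [InnerProductSpace.HarmonicOnNhd.circleAverage_eq]
    intro y hy
    rw [abs_of_pos hr.1] at hy
    exact hb y (closedBall_subset_ball hr.2 hy)

lemma local_submean (hw : IsNodal w U) (hU : IsOpen U) {x : ℂ} (hx : x ∈ U) :
    ∃ ε > 0, ∀ r ∈ Ioo 0 ε, w x ≤ Real.circleAverage w x r := by
  have h := hw.local_submean_sub hU (H := 0)
    (fun y => InnerProductSpace.harmonicAt_const (0 : ℝ)) hx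
  simpa only [sub_zero] using h

/-- A nodal function is dominated on a closed disk by its values on the boundary circle. -/
lemma exists_sphere_ge (hw : IsNodal w U) (hU : IsOpen U) {c : ℂ} {s : ℝ}
    (hs : 0 ≤ s) (hsU : closedBall c s ⊆ U) {x : ℂ} (hx : x ∈ closedBall c s) :
    ∃ q ∈ sphere c s, w x ≤ w q := by
  obtain ⟨q, hq, hmax⟩ := (isCompact_sphere c s).exists_isMaxOn
    (NormedSpace.sphere_nonempty.2 hs)
    (hw.continuousOn.mono (sphere_subset_closedBall.trans hsU))
  exact ⟨q, hq, le_of_local_submean (hw.continuousOn.mono hsU)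
    (fun y hy => hw.local_submean hU (hsU (ball_subset_closedBall hy))) (fun y hy => hmax hy) x hx⟩

open InnerProductSpace in
/-- Sub-mean value inequality over a circle. -/
lemma le_circleAverage (hw : IsNodal w U) (hU : IsOpen U) {c : ℂ} {s : ℝ}
    (hs : 0 < s) (hsU : closedBall c s ⊆ U) : w c ≤ Real.circleAverage w c s := by
  have hsph := sphere_subset_closedBall.trans hsU
  refine le_of_forall_pos_le_add fun ε hε => ?_
  obtain ⟨H, hH, hHw⟩ := exists_harmonic_near_on_sphere hs (half_pos hε)
    (hw.continuousOn.mono hsph)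
  have hHc : Continuous H := continuous_iff_continuousAt.2 fun y => (hH y).1.continuousAt
  have h1 : (w - H) c ≤ ε / 2 := by
    refine le_of_local_submean ((hw.continuousOn.mono hsU).sub hHc.continuousOn)
      (fun y hy => hw.local_submean_sub hU hH (hsU (ball_subset_closedBall hy)))
      (fun y hy => ?_) c (mem_closedBall_self hs.le)
    have := neg_le_of_abs_le (hHw y hy)
    simp only [Pi.sub_apply]
    linarith
  have h2 : H c = Real.circleAverage H c s :=
    (InnerProductSpace.HarmonicOnNhd.circleAverage_eq (fun y _ => hH y)).symm
  have hwi : CircleIntegrable w c s := (hw.continuousOn.mono hsph).circleIntegrable hs.le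
  have h3 : Real.circleAverage (H - w) c s ≤ ε / 2 := by
    refine Real.circleAverage_mono_on_of_le_circle
      ((hHc.continuousOn.circleIntegrable hs.le).sub hwi) fun x hx => ?_
    rw [abs_of_pos hs] at hx
    exact le_of_abs_le (hHw x hx)
  rw [Real.circleAverage_sub (hHc.continuousOn.circleIntegrable hs.le) hwi] at h3
  simp only [Pi.sub_apply] at h1
  linarith

lemma isOpen_ne_zero (hw : IsNodal w U) {V : Set ℂ} (hV : IsOpen V)
    (hVU : V ⊆ U) : IsOpen ({x | w x ≠ 0} ∩ V) := by
  rw [inter_comm]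
  exact (hw.continuousOn.mono hVU).isOpen_inter_preimage hV isOpen_ne

/-- Sub-mean value inequality over a disk. -/
lemma mul_area_le (hw : IsNodal w U) (hU : IsOpen U) {c : ℂ} {ρ B : ℝ} (hρ : 0 < ρ)
    (hρU : ball c ρ ⊆ U) (hB : ∀ x ∈ ball c ρ, w x ≤ B) :
    w c * (Real.pi * ρ ^ 2) ≤ B * volume.real ({x | w x ≠ 0} ∩ ball c ρ) := by
  have hcB := hB c (mem_ball_self hρ)
  rcases (hw.nonneg c).eq_or_lt with h0 | hpos
  · rw [← h0, zero_mul]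
    have : 0 ≤ B := (hw.nonneg c).trans hcB
    positivity
  have hBpos : 0 < B := hpos.trans_le hcB
  set S : Set ℂ := (fun x => c + x) ⁻¹' ({x | w x ≠ 0} ∩ ball c ρ) with hS
  have hSm : MeasurableSet S :=
    ((hw.isOpen_ne_zero isOpen_ball hρU).preimage (by fun_prop)).measurableSet
  have hvol : volume S = volume ({x | w x ≠ 0} ∩ ball c ρ) := measure_preimage_add _ _ _
  have hpol : volume S = ∫⁻ r in Ioi (0 : ℝ), ∫⁻ θ in Ioo (-Real.pi) Real.pi,
      ENNReal.ofReal r * S.indicator 1 (Complex.polarCoord.symm (r, θ)) := by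
    rw [← lintegral_indicator_one hSm, ← Complex.lintegral_comp_polarCoord_symm]
    have hmeas : Measurable fun p : ℝ × ℝ =>
        ENNReal.ofReal p.1 * S.indicator (1 : ℂ → ENNReal) (Complex.polarCoord.symm p) := by
      refine (by fun_prop : Measurable fun p : ℝ × ℝ => ENNReal.ofReal p.1).mul ?_
      refine (measurable_one.indicator hSm).comp ?_
      rw [show ⇑Complex.polarCoord.symm = fun p : ℝ × ℝ => _ from
        funext Complex.polarCoord_symm_apply]
      fun_prop
    rw [polarCoord_target, Measure.volume_eq_prod, ← Measure.prod_restrict]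
    exact lintegral_prod _ hmeas.aemeasurable
  have hin : ∀ r ∈ Ioo 0 ρ, ENNReal.ofReal (2 * Real.pi * w c / B) * ENNReal.ofReal r ≤
      ∫⁻ θ in Ioo (-Real.pi) Real.pi,
        ENNReal.ofReal r * S.indicator 1 (Complex.polarCoord.symm (r, θ)) := by
    intro r hr
    have hcm : ∀ θ, circleMap c r θ = c + Complex.polarCoord.symm (r, θ) := fun θ => by
      simp [circleMap, Complex.exp_mul_I]
    have hin_ball : ∀ θ, circleMap c r θ ∈ ball c ρ := fun θ =>
      closedBall_subset_ball hr.2 (circleMap_mem_closedBall c hr.1.le θ)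
    have hcont : Continuous fun θ => w (circleMap c r θ) := by
      rw [← continuousOn_univ]
      exact hw.continuousOn.comp (by fun_prop) fun θ _ => hρU (hin_ball θ)
    rw [lintegral_const_mul' _ _ ENNReal.ofReal_ne_top, mul_comm]
    gcongr
    have h1 : ∀ θ, ENNReal.ofReal (w (circleMap c r θ) / B) ≤
        S.indicator 1 (Complex.polarCoord.symm (r, θ)) := by
      intro θ
      by_cases h : w (circleMap c r θ) = 0
      · simp [h]
      · have : Complex.polarCoord.symm (r, θ) ∈ S := by
          rw [hS, mem_preimage, ← hcm]
          exact ⟨h, hin_ball θ⟩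
        rw [indicator_of_mem this]
        refine ENNReal.ofReal_le_one.2 ((div_le_one hBpos).2 (hB _ (hin_ball θ)))
    refine le_trans ?_ (lintegral_mono h1)
    rw [← ofReal_integral_eq_lintegral_ofReal]
    · apply ENNReal.ofReal_le_ofReal
      rw [integral_div]
      gcongr
      have h2 := hw.le_circleAverage hU hr.1 ((closedBall_subset_ball hr.2).trans hρU)
      rw [Real.circleAverage_eq_integral_add (-Real.pi), intervalIntegral.integral_comp_add_right
        (fun θ => w (circleMap c r θ)), smul_eq_mul, ← div_eq_inv_mul,
        le_div_iff₀ Real.two_pi_pos] at h2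
      rw [← integral_Ioc_eq_integral_Ioo, ← intervalIntegral.integral_of_le
        (by linarith [Real.pi_pos])]
      convert h2 using 1
      · ring
      · congr 1 <;> ring
    · exact (hcont.div_const B).continuousOn.integrableOn_Icc.mono_set Ioo_subset_Icc_self
    · exact Filter.Eventually.of_forall fun θ => div_nonneg (hw.nonneg _) hBpos.le
  have hfin : volume S ≠ ⊤ := by
    rw [hvol]
    exact ((measure_mono inter_subset_right).trans_lt measure_ball_lt_top).ne
  have hmain : ENNReal.ofReal (2 * Real.pi * w c / B * (ρ ^ 2 / 2)) ≤ volume S := by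
    rw [hpol]
    calc ENNReal.ofReal (2 * Real.pi * w c / B * (ρ ^ 2 / 2))
        = ∫⁻ r in Ioo 0 ρ, ENNReal.ofReal (2 * Real.pi * w c / B) * ENNReal.ofReal r := by
          have hpos2 : 0 ≤ 2 * Real.pi * w c / B := by positivity
          rw [lintegral_const_mul' _ _ ENNReal.ofReal_ne_top, ENNReal.ofReal_mul hpos2]
          congr 1
          rw [← ofReal_integral_eq_lintegral_ofReal]
          · rw [← integral_Ioc_eq_integral_Ioo, ← intervalIntegral.integral_of_le hρ.le,
              integral_id]
            simp
          · exact continuous_id.continuousOn.integrableOn_Icc.mono_set Ioo_subset_Icc_self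
          · exact (ae_restrict_mem measurableSet_Ioo).mono fun r hr => hr.1.le
      _ ≤ ∫⁻ r in Ioo 0 ρ, ∫⁻ θ in Ioo (-Real.pi) Real.pi,
            ENNReal.ofReal r * S.indicator 1 (Complex.polarCoord.symm (r, θ)) :=
          setLIntegral_mono' measurableSet_Ioo hin
      _ ≤ _ := lintegral_mono_set Ioo_subset_Ioi_self
  rw [ENNReal.ofReal_le_iff_le_toReal hfin, hvol] at hmain
  have : 2 * Real.pi * w c / B * (ρ ^ 2 / 2) = w c * (Real.pi * ρ ^ 2) / B := by ring
  rw [this, div_le_iff₀ hBpos] at hmain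
  rw [mul_comm B]
  exact hmain

end IsNodal

lemma prod_le_mean_pow {n : ℕ} (hn : 0 < n) {a : ℕ → ℝ} (ha : ∀ i, 0 ≤ a i) :
    ∏ i ∈ Finset.range n, a i ≤ ((∑ i ∈ Finset.range n, a i) / n) ^ n := by
  have hn' : (0 : ℝ) < n := by exact_mod_cast hn
  have h := Real.geom_mean_le_arith_mean_weighted (Finset.range n) (fun _ => (1 / n : ℝ)) a
    (fun _ _ => by positivity) (by simp [hn'.ne']) (fun i _ => ha i)
  have h2 := pow_le_pow_left₀ (Finset.prod_nonneg fun i _ => Real.rpow_nonneg (ha i) _) h n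
  rw [← Finset.prod_pow] at h2
  have h3 : ∀ i ∈ Finset.range n, (a i ^ (1 / n : ℝ)) ^ n = a i := fun i _ => by
    rw [one_div, Real.rpow_inv_natCast_pow (ha i) hn.ne']
  rw [Finset.prod_congr rfl h3, ← Finset.mul_sum] at h2
  rwa [div_eq_inv_mul, ← one_div]

/-- A nodal function whose support has small area decays quickly towards the interior. -/
lemma IsNodal.le_mul_pow {w : ℂ → ℝ} (hw : IsNodal w (ball 0 2)) {M : ℝ}
    (hM : ∀ x ∈ ball (0 : ℂ) 2, w x ≤ M) {n : ℕ} (hn : 0 < n) {x : ℂ}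
    (hx : x ∈ ball (0 : ℂ) (3 / 2)) :
    w x ≤ M * (6 * n * volume.real ({x | w x ≠ 0} ∩ ball 0 2)) ^ n := by
  have hn' : (0 : ℝ) < n := by exact_mod_cast hn
  have hM0 : 0 ≤ M := (hw.nonneg 0).trans (hM 0 (by simp))
  set S := {x | w x ≠ 0} ∩ ball 0 2 with hS
  set ρ : ℝ := 1 / (4 * n) with hρ
  have hρ0 : 0 < ρ := by positivity
  set r : ℕ → ℝ := fun i => 3 / 2 + i * (2 * ρ) with hr
  have hrs : ∀ i, r (i + 1) = r i + 2 * ρ := fun i => by simp only [hr]; push_cast; ring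
  have hr0 : ∀ i, 0 < r i := fun i => by positivity
  have hrn : r n = 2 := by simp only [hr, hρ]; field_simp; norm_num
  have hrmono : Monotone r := monotone_nat_of_le_succ fun i => by rw [hrs]; linarith
  set T : ℕ → Set ℂ := fun i => {x : ℂ | r i < ‖x‖ ∧ ‖x‖ < r (i + 1)} with hT
  have hTo : ∀ i, IsOpen (T i) := fun i =>
    (isOpen_lt continuous_const continuous_norm).inter (isOpen_lt continuous_norm continuous_const)
  set a : ℕ → ℝ := fun i => volume.real (S ∩ T i) with ha
  have hSfin : volume S ≠ ⊤ := ((measure_mono inter_subset_right).trans_lt measure_ball_lt_top).ne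
  have step : ∀ j ≤ n, ∀ B, (∀ x ∈ ball (0 : ℂ) (r j), w x ≤ B) →
      ∀ x ∈ ball (0 : ℂ) (r 0), w x ≤ B * ∏ i ∈ Finset.range j, (a i / (Real.pi * ρ ^ 2)) := by
    intro j
    induction j with
    | zero => intro _ B hB x hx; simpa using hB x hx
    | succ j ih =>
      intro hj B hB x hx
      rw [Finset.prod_range_succ, mul_comm (∏ i ∈ Finset.range j, _), ← mul_assoc]
      refine ih (by omega) _ (fun y hy => ?_) x hx
      have hr2 : r (j + 1) ≤ 2 := hrn ▸ hrmono hj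
      have hB0 : 0 ≤ B := (hw.nonneg 0).trans (hB 0 (mem_ball_self (hr0 _)))
      obtain ⟨q, hq, hyq⟩ := hw.exists_sphere_ge isOpen_ball (c := 0) (s := r j + ρ)
        (by have := hr0 j; positivity)
        (closedBall_subset_ball (by have := hrs j; linarith)) (x := y) (by
          rw [mem_ball] at hy; rw [mem_closedBall]; linarith)
      rw [mem_sphere_zero_iff_norm] at hq
      have hqT : ball q ρ ⊆ T j := by
        intro z hz
        rw [mem_ball, dist_eq_norm] at hz
        have h1 := norm_sub_norm_le q z
        have h2 := norm_sub_norm_le z q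
        rw [norm_sub_rev] at h1
        have := hrs j
        constructor <;> linarith
      have hTb : T j ⊆ ball 0 (r (j + 1)) := fun z hz => by simpa using hz.2
      have hqU : ball q ρ ⊆ ball 0 2 := (hqT.trans hTb).trans (ball_subset_ball hr2)
      have h1 := hw.mul_area_le isOpen_ball hρ0 hqU (fun z hz => hB z (hTb (hqT hz)))
      have h2 : volume.real ({x | w x ≠ 0} ∩ ball q ρ) ≤ a j :=
        measureReal_mono (fun z hz => ⟨⟨hz.1, hqU hz.2⟩, hqT hz.2⟩)
          (ne_top_of_le_ne_top hSfin (measure_mono inter_subset_left))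
      refine hyq.trans ?_
      rw [← mul_div_assoc, le_div_iff₀ (by positivity)]
      exact h1.trans (mul_le_mul_of_nonneg_left h2 hB0)
  have h0 := step n le_rfl M (by rwa [hrn]) x (by simpa [hr] using hx)
  refine h0.trans (mul_le_mul_of_nonneg_left ?_ hM0)
  refine (prod_le_mean_pow hn fun i => by positivity).trans ?_
  have hsum : ∑ i ∈ Finset.range n, a i ≤ volume.real S := by
    rw [← measureReal_biUnion_finset]
    · exact measureReal_mono (iUnion₂_subset fun i _ => inter_subset_left) hSfin
    · intro i _ j _ hij
      rw [Function.onFun, Set.disjoint_left]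
      rintro z ⟨_, h1, h2⟩ ⟨_, h3, h4⟩
      rcases lt_or_gt_of_ne hij with h | h
      · have := hrmono (Nat.succ_le_of_lt h)
        simp only [Nat.succ_eq_add_one] at this
        linarith
      · have := hrmono (Nat.succ_le_of_lt h)
        simp only [Nat.succ_eq_add_one] at this
        linarith
    · intro i _
      exact ((hw.isOpen_ne_zero isOpen_ball subset_rfl).inter (hTo i)).measurableSet
  have hvol0 : 0 ≤ volume.real S := measureReal_nonneg
  refine pow_le_pow_left₀ (div_nonneg (Finset.sum_nonneg fun i _ => by positivity) hn'.le) ?_ n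
  rw [← Finset.sum_div, div_div, div_le_iff₀ (by positivity)]
  refine hsum.trans ?_
  have : 6 * n * volume.real S * (Real.pi * ρ ^ 2 * n) = volume.real S * (6 * Real.pi / 16) := by
    rw [hρ]; field_simp; norm_num
  rw [this]
  have := Real.pi_gt_three
  nlinarith

lemma prod_abs_sub_eq_factorial (k m : ℕ) :
    ∏ j ∈ (Finset.range (k + 1 + m)).erase k, |(j : ℝ) - k| = k.factorial * m.factorial := by
  have h1 : ∏ j ∈ (Finset.range (k + 1 + m)).erase k, |(j : ℝ) - k|
      = ∏ j ∈ Finset.range (k + 1 + m), (if j = k then 1 else |(j : ℝ) - k|) := by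
    rw [← Finset.mul_prod_erase (Finset.range (k + 1 + m)) (fun j : ℕ => if j = k then (1 : ℝ) else
      |(j : ℝ) - k|) (a := k) (by simp; omega)]
    simp only [if_true, one_mul]
    exact Finset.prod_congr rfl fun j hj => by rw [if_neg (Finset.ne_of_mem_erase hj)]
  rw [h1, Finset.prod_range_add, Finset.prod_range_succ, if_pos rfl, mul_one]
  congr 1
  · rw [← Finset.prod_range_add_one_eq_factorial, ← Finset.prod_range_reflect]
    push_cast
    refine Finset.prod_congr rfl fun j hj => ?_
    rw [Finset.mem_range] at hj
    have h2 : ((k - 1 - j : ℕ) : ℝ) = k - 1 - j := by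
      rw [Nat.sub_sub, Nat.cast_sub (by omega)]; push_cast; ring
    have hjk : (j : ℝ) + 1 ≤ k := by exact_mod_cast hj
    rw [if_neg (by omega), h2, abs_of_nonpos (by linarith [(Nat.cast_nonneg j : (0 : ℝ) ≤ j)])]
    ring
  · rw [← Finset.prod_range_add_one_eq_factorial]
    push_cast
    refine Finset.prod_congr rfl fun j _ => ?_
    rw [if_neg (by omega), show (k : ℝ) + 1 + j - k = j + 1 by ring]
    exact abs_of_pos (by positivity)

lemma inv_pow_le_prod_abs_sub {n k : ℕ} (hk : k < n) :
    ((200 : ℝ) ^ n)⁻¹ ≤ ∏ j ∈ (Finset.range n).erase k, (|(j : ℝ) - k| / (28 * n)) := by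
  obtain ⟨m, rfl⟩ : ∃ m, n = k + 1 + m := ⟨n - (k + 1), by omega⟩
  set n := k + 1 + m with hn
  have hn0 : (0 : ℝ) < n := by positivity
  rw [Finset.prod_div_distrib, prod_abs_sub_eq_factorial, Finset.prod_const,
    Finset.card_erase_of_mem (by simpa using hk), Finset.card_range,
    inv_eq_one_div, div_le_div_iff₀ (by positivity) (by positivity), one_mul]
  have hnm : n - 1 = k + m := by omega
  have h1 : ((k + m).factorial : ℝ) ≤ 2 ^ (k + m) * (k.factorial * m.factorial) := by
    have h := Nat.add_choose_mul_factorial_mul_factorial k m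
    have h2 := Nat.choose_le_two_pow (k + m) m
    rw [← h, mul_assoc]
    exact_mod_cast Nat.mul_le_mul_right _ h2
  have h3 : (n : ℝ) ^ n ≤ Real.exp n * n.factorial := by
    have := Real.pow_div_factorial_le_exp (n : ℝ) hn0.le n
    rwa [div_le_iff₀ (by positivity)] at this
  have h4 : (n : ℝ) ^ (k + m) ≤ Real.exp n * (k + m).factorial := by
    have hs : n = (k + m) + 1 := by omega
    have hf : (n.factorial : ℝ) = n * (k + m).factorial := by
      conv_lhs => rw [hs, Nat.factorial_succ]
      rw [hs]; push_cast; ring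
    have hp : (n : ℝ) ^ n = n * n ^ (k + m) := by
      conv_lhs => rw [show (n : ℝ) ^ n = n ^ ((k + m) + 1) by rw [← hs], pow_succ']
    rw [hf, hp, mul_left_comm] at h3
    exact le_of_mul_le_mul_left h3 hn0
  have h5 : Real.exp n ≤ 3 ^ n := by
    have := pow_le_pow_left₀ (Real.exp_pos 1).le
      (Real.exp_one_lt_d9.le.trans (by norm_num : (2.7182818286 : ℝ) ≤ 3)) n
    rwa [← Real.exp_nat_mul, mul_one] at this
  rw [hnm, mul_pow]
  calc (28 : ℝ) ^ (k + m) * n ^ (k + m)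
      ≤ 28 ^ (k + m) * (3 ^ n * (2 ^ (k + m) * (k.factorial * m.factorial))) := by
        gcongr
        exact h4.trans (mul_le_mul h5 h1 (by positivity) (by positivity))
    _ = (56 ^ (k + m) * 3 ^ n) * (k.factorial * m.factorial) := by
        rw [show (56 : ℝ) = 28 * 2 by norm_num, mul_pow]; ring
    _ ≤ (k.factorial * m.factorial) * 200 ^ n := by
        rw [mul_comm]
        gcongr
        calc (56 : ℝ) ^ (k + m) * 3 ^ n ≤ 56 ^ n * 3 ^ n := by
              gcongr
              · norm_num
              · omega
          _ = 168 ^ n := by rw [← mul_pow]; norm_num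
          _ ≤ 200 ^ n := by gcongr; norm_num

/-- The Blaschke factor of the disk of radius `7 / 4` with zero `a`. -/
noncomputable def blaschke (a z : ℂ) : ℂ :=
  (7 / 4) * (z - a) / ((7 / 4) ^ 2 - (starRingEnd ℂ) a * z)

lemma normSq_blaschke_denom_sub (a z : ℂ) :
    ‖(7 / 4) ^ 2 - (starRingEnd ℂ) a * z‖ ^ 2 - ‖(7 / 4) * (z - a)‖ ^ 2
      = ((7 / 4) ^ 2 - ‖a‖ ^ 2) * ((7 / 4) ^ 2 - ‖z‖ ^ 2) := by
  rw [show ((7 / 4) ^ 2 : ℂ) = ((49 / 16 : ℝ) : ℂ) by push_cast; norm_num,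
    show (7 / 4 : ℂ) = ((7 / 4 : ℝ) : ℂ) by push_cast; norm_num]
  simp only [Complex.sq_norm, Complex.normSq_apply, Complex.sub_re, Complex.sub_im, Complex.mul_re,
    Complex.mul_im, Complex.conj_re, Complex.conj_im, Complex.ofReal_re, Complex.ofReal_im]
  ring

lemma blaschke_denom_ne_zero {a z : ℂ} (ha : ‖a‖ ≤ 4 / 3) (hz : ‖z‖ < 2) :
    ((7 / 4) ^ 2 - (starRingEnd ℂ) a * z : ℂ) ≠ 0 := by
  intro h
  have h1 : ‖((7 / 4) ^ 2 : ℂ)‖ = ‖a‖ * ‖z‖ := by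
    rw [sub_eq_zero.1 h, norm_mul, Complex.norm_conj]
  norm_num at h1
  nlinarith [norm_nonneg a, norm_nonneg z]

lemma norm_blaschke_le_one {a z : ℂ} (ha : ‖a‖ ≤ 4 / 3) (hz : ‖z‖ ≤ 7 / 4) :
    ‖blaschke a z‖ ≤ 1 := by
  have h0 := norm_pos_iff.2 (blaschke_denom_ne_zero ha (hz.trans_lt (by norm_num)))
  rw [blaschke, norm_div, div_le_one h0]
  refine le_of_sq_le_sq ?_ h0.le
  have := normSq_blaschke_denom_sub a z
  have h1 : 0 ≤ ((7 / 4) ^ 2 - ‖a‖ ^ 2) * ((7 / 4) ^ 2 - ‖z‖ ^ 2) := by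
    apply mul_nonneg <;> nlinarith [norm_nonneg a, norm_nonneg z]
  linarith

lemma norm_blaschke_eq_one {a z : ℂ} (ha : ‖a‖ ≤ 4 / 3) (hz : ‖z‖ = 7 / 4) :
    ‖blaschke a z‖ = 1 := by
  have h0 := norm_pos_iff.2 (blaschke_denom_ne_zero ha (hz.trans_lt (by norm_num)))
  rw [blaschke, norm_div, div_eq_one_iff_eq h0.ne']
  have := normSq_blaschke_denom_sub a z
  rw [hz, sub_self, mul_zero, sub_eq_zero] at this
  exact ((sq_eq_sq₀ (norm_nonneg _) (norm_nonneg _)).1 this).symm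

lemma norm_blaschke_le {a z : ℂ} (ha : ‖a‖ ≤ 4 / 3) (hz : ‖z‖ ≤ 1) :
    ‖blaschke a z‖ ≤ 19 / 20 := by
  have h0 := norm_pos_iff.2 (blaschke_denom_ne_zero ha (hz.trans_lt (by norm_num)))
  rw [blaschke, norm_div, div_le_iff₀ h0]
  refine le_of_sq_le_sq ?_ (by positivity)
  have h := normSq_blaschke_denom_sub a z
  have ha0 := norm_nonneg a
  have hz0 := norm_nonneg z
  have h1 : (185 / 144 : ℝ) * (33 / 16) ≤ ((7 / 4) ^ 2 - ‖a‖ ^ 2) * ((7 / 4) ^ 2 - ‖z‖ ^ 2) := by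
    apply mul_le_mul <;> nlinarith
  have h2 : ‖((7 / 4) ^ 2 - (starRingEnd ℂ) a * z : ℂ)‖ ≤ 49 / 16 + 4 / 3 := by
    refine (norm_sub_le _ _).trans ?_
    rw [norm_mul, Complex.norm_conj]
    norm_num
    nlinarith
  nlinarith

lemma le_norm_blaschke {a z : ℂ} (ha : ‖a‖ ≤ 4 / 3) (hz : ‖z‖ ≤ 4 / 3) :
    2 / 7 * ‖z - a‖ ≤ ‖blaschke a z‖ := by
  have h0 := norm_pos_iff.2 (blaschke_denom_ne_zero ha (hz.trans_lt (by norm_num)))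
  rw [blaschke, norm_div, le_div_iff₀ h0, norm_mul]
  have h2 : ‖((7 / 4) ^ 2 - (starRingEnd ℂ) a * z : ℂ)‖ ≤ 49 / 8 := by
    refine (norm_sub_le _ _).trans ?_
    rw [norm_mul, Complex.norm_conj]
    norm_num
    nlinarith [norm_nonneg a, norm_nonneg z]
  have h3 : ‖(7 / 4 : ℂ)‖ = 7 / 4 := by norm_num
  rw [h3]
  nlinarith [norm_nonneg (z - a), mul_le_mul_of_nonneg_left h2 (norm_nonneg (z - a))]

lemma differentiableOn_blaschke {a : ℂ} (ha : ‖a‖ ≤ 4 / 3) :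
    DifferentiableOn ℂ (blaschke a) (ball 0 2) := by
  unfold blaschke
  refine DifferentiableOn.div (by fun_prop) (by fun_prop) fun z hz => ?_
  exact blaschke_denom_ne_zero ha (by simpa using hz)

/-- A holomorphic function is divisible by the linear factors of finitely many of its zeros. -/
lemma exists_eq_prod_sub_mul {ι : Type*} {S : Finset ι} {z : ι → ℂ} {U : Set ℂ}
    (hU : IsOpen U) (hinj : Set.InjOn z S) (hz : ∀ k ∈ S, z k ∈ U) {G : ℂ → ℂ}
    (hG : DifferentiableOn ℂ G U) (h0 : ∀ k ∈ S, G (z k) = 0) :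
    ∃ G₁, DifferentiableOn ℂ G₁ U ∧ ∀ x, G x = (∏ k ∈ S, (x - z k)) * G₁ x := by
  classical
  induction S using Finset.induction_on with
  | empty => exact ⟨G, hG, by simp⟩
  | insert a S ha ih =>
    obtain ⟨G₁, hd, hf⟩ := ih (hinj.mono (by simp)) (fun k hk => hz k (by simp [hk]))
      (fun k hk => h0 k (by simp [hk]))
    have hzero : G₁ (z a) = 0 := by
      have := h0 a (by simp)
      rw [hf, mul_eq_zero, Finset.prod_eq_zero_iff] at this
      refine this.resolve_left ?_
      rintro ⟨k, hk, hka⟩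
      have := hinj (by simp) (by simp [hk]) (sub_eq_zero.1 hka)
      exact ha (this ▸ hk)
    refine ⟨dslope G₁ (z a),
      (Complex.differentiableOn_dslope (hU.mem_nhds (hz a (by simp)))).2 hd, fun x => ?_⟩
    have := sub_smul_dslope G₁ (z a) x
    rw [hzero, sub_zero, smul_eq_mul] at this
    rw [hf, Finset.prod_insert ha, ← this]
    ring

/-- Schwarz lemma for a function with prescribed zeros. -/
lemma norm_le_mul_prod_blaschke {ι : Type*} {S : Finset ι} {z : ι → ℂ}
    (hinj : Set.InjOn z S) (hz : ∀ k ∈ S, ‖z k‖ ≤ 4 / 3) {G : ℂ → ℂ}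
    (hG : DifferentiableOn ℂ G (ball 0 2)) (h0 : ∀ k ∈ S, G (z k) = 0) {B : ℝ}
    (hB : ∀ x, ‖x‖ = 7 / 4 → ‖G x‖ ≤ B) {x : ℂ} (hx : ‖x‖ ≤ 7 / 4) :
    ‖G x‖ ≤ B * ∏ k ∈ S, ‖blaschke (z k) x‖ := by
  obtain ⟨G₁, hd, hf⟩ := exists_eq_prod_sub_mul isOpen_ball hinj
    (fun k hk => by rw [mem_ball_zero_iff]; linarith [hz k hk]) hG h0
  set Q : ℂ → ℂ := fun x =>
    (∏ k ∈ S, (((7 / 4) ^ 2 - (starRingEnd ℂ) (z k) * x) / (7 / 4))) * G₁ x with hQ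
  have hQd : DifferentiableOn ℂ Q (ball 0 2) := by
    refine DifferentiableOn.mul ?_ hd
    refine DifferentiableOn.fun_finsetProd fun k _ => ?_
    fun_prop
  have hfac : ∀ x, ‖x‖ ≤ 7 / 4 → G x = Q x * ∏ k ∈ S, blaschke (z k) x := by
    intro x hx
    rw [hf, hQ]
    simp only
    rw [mul_right_comm, ← Finset.prod_mul_distrib]
    congr 1
    refine Finset.prod_congr rfl fun k hk => ?_
    rw [blaschke, div_mul_div_comm, mul_left_comm, mul_comm (7 / 4 : ℂ) (_ - _)]
    have := blaschke_denom_ne_zero (hz k hk) (hx.trans_lt (by norm_num))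
    generalize (7 / 4 : ℂ) ^ 2 - (starRingEnd ℂ) (z k) * x = d at this ⊢
    field_simp
  have hball : closedBall (0 : ℂ) (7 / 4) ⊆ ball 0 2 := closedBall_subset_ball (by norm_num)
  have hQB : ‖Q x‖ ≤ B := by
    refine Complex.norm_le_of_forall_mem_frontier_norm_le (U := ball (0 : ℂ) (7 / 4))
      isBounded_ball ?_ (fun y hy => ?_) ?_
    · exact (hQd.mono (by rwa [closure_ball _ (by norm_num)])).diffContOnCl
    · rw [frontier_ball _ (by norm_num), mem_sphere_zero_iff_norm] at hy
      have h1 := hB y hy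
      rw [hfac y hy.le, norm_mul, norm_prod, Finset.prod_eq_one fun k hk =>
        norm_blaschke_eq_one (hz k hk) hy, mul_one] at h1
      exact h1
    · rw [closure_ball _ (by norm_num)]; simpa using hx
  rw [hfac x hx, norm_mul, norm_prod]
  gcongr

/-- A bounded holomorphic function that is tiny at many separated points is small. -/
lemma norm_le_of_small_at_points {n : ℕ} {z : ℕ → ℂ} (hz : ∀ k < n, ‖z k‖ ≤ 4 / 3)
    (hsep : ∀ j < n, ∀ k < n, |(j : ℝ) - k| / (8 * n) ≤ ‖z j - z k‖) {g : ℂ → ℂ}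
    (hg : DifferentiableOn ℂ g (ball 0 2)) {B η : ℝ} (hB : ∀ x, ‖x‖ = 7 / 4 → ‖g x‖ ≤ B)
    (hη : ∀ k < n, ‖g (z k)‖ ≤ η) {x : ℂ} (hx : ‖x‖ ≤ 1) :
    ‖g x‖ ≤ (B + n * η * 200 ^ n) * (19 / 20) ^ n + n * η * 200 ^ n := by
  set P : ℂ → ℂ := fun x => ∑ k ∈ Finset.range n, g (z k) *
    ∏ j ∈ (Finset.range n).erase k, (blaschke (z j) x / blaschke (z j) (z k)) with hP
  have hne : ∀ j < n, ∀ k < n, j ≠ k → z j ≠ z k := by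
    intro j hj k hk hjk h
    have h1 := hsep j hj k hk
    rw [h, sub_self, norm_zero] at h1
    have h2 : 0 < |(j : ℝ) - k| := abs_pos.2 (sub_ne_zero.2 (by exact_mod_cast hjk))
    have h3 : (0 : ℝ) < n := by exact_mod_cast (by omega : 0 < n)
    have : 0 < |(j : ℝ) - k| / (8 * n) := by positivity
    linarith
  have hPd : DifferentiableOn ℂ P (ball 0 2) := by
    refine DifferentiableOn.fun_sum fun k _ => DifferentiableOn.const_mul ?_ _
    refine DifferentiableOn.fun_finsetProd fun j hj => DifferentiableOn.div_const ?_ _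
    exact differentiableOn_blaschke (hz j (by simp at hj; exact hj.2))
  have hbl : ∀ j < n, ∀ k < n, |(j : ℝ) - k| / (28 * n) ≤ ‖blaschke (z j) (z k)‖ := by
    intro j hj k hk
    refine le_trans ?_ (le_norm_blaschke (hz j hj) (hz k hk))
    rw [norm_sub_rev]
    have := mul_le_mul_of_nonneg_left (hsep j hj k hk) (by norm_num : (0 : ℝ) ≤ 2 / 7)
    refine le_trans (le_of_eq ?_) this
    have h3 : (0 : ℝ) < n := by exact_mod_cast (by omega : 0 < n)
    field_simp
    ring
  have hPB : ∀ x, ‖x‖ ≤ 7 / 4 → ‖P x‖ ≤ n * η * 200 ^ n := by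
    intro x hx
    refine (norm_sum_le _ _).trans ?_
    have : ∀ k ∈ Finset.range n, ‖g (z k) * ∏ j ∈ (Finset.range n).erase k,
        (blaschke (z j) x / blaschke (z j) (z k))‖ ≤ η * 200 ^ n := by
      intro k hk
      rw [Finset.mem_range] at hk
      rw [norm_mul]
      refine mul_le_mul (hη k hk) ?_ (norm_nonneg _) ((norm_nonneg _).trans (hη k hk))
      rw [Finset.prod_div_distrib, norm_div, norm_prod, norm_prod]
      have h1 : ∏ j ∈ (Finset.range n).erase k, ‖blaschke (z j) x‖ ≤ 1 :=
        Finset.prod_le_one (fun _ _ => norm_nonneg _) fun j hj =>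
          norm_blaschke_le_one (hz j (by simp at hj; exact hj.2)) hx
      have h2 : ((200 : ℝ) ^ n)⁻¹ ≤ ∏ j ∈ (Finset.range n).erase k, ‖blaschke (z j) (z k)‖ :=
        (inv_pow_le_prod_abs_sub hk).trans (Finset.prod_le_prod (fun _ _ => by positivity)
          fun j hj => hbl j (by simp at hj; exact hj.2) k hk)
      have h3 : (0 : ℝ) < ((200 : ℝ) ^ n)⁻¹ := by positivity
      rw [div_le_iff₀ (h3.trans_le h2)]
      refine h1.trans ?_
      have := mul_le_mul_of_nonneg_left h2 (by positivity : (0 : ℝ) ≤ 200 ^ n)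
      rwa [mul_inv_cancel₀ (by positivity)] at this
    refine (Finset.sum_le_sum this).trans (le_of_eq ?_)
    rw [Finset.sum_const, Finset.card_range, nsmul_eq_mul, mul_assoc]
  have hPz : ∀ k < n, P (z k) = g (z k) := by
    intro k hk
    rw [hP]
    simp only
    rw [Finset.sum_eq_single k]
    · rw [Finset.prod_eq_one, mul_one]
      intro j hj
      rw [Finset.mem_erase, Finset.mem_range] at hj
      refine div_self ?_
      rw [← norm_pos_iff]
      have := le_norm_blaschke (hz j hj.2) (hz k hk)
      have h2 := norm_pos_iff.2 (sub_ne_zero.2 (hne k hk j hj.2 hj.1.symm))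
      linarith
    · intro i _ hik
      rw [Finset.prod_eq_zero (i := k), mul_zero]
      · rw [Finset.mem_erase, Finset.mem_range]; exact ⟨hik.symm, hk⟩
      · simp [blaschke]
    · intro h; exact absurd (Finset.mem_range.2 hk) h
  have hmain := norm_le_mul_prod_blaschke (S := Finset.range n) (z := z) (G := g - P)
    (fun j hj k hk h => by
      by_contra hjk
      exact hne j (by simpa using hj) k (by simpa using hk) hjk h)
    (fun k hk => hz k (by simpa using hk)) (hg.sub hPd)
    (fun k hk => by simp [hPz k (by simpa using hk)])
    (B := B + n * η * 200 ^ n)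
    (fun y hy => (norm_sub_le _ _).trans (add_le_add (hB y hy) (hPB y hy.le)))
    (hx.trans (by norm_num))
  have hprod : ∏ k ∈ Finset.range n, ‖blaschke (z k) x‖ ≤ (19 / 20) ^ n := by
    refine (Finset.prod_le_prod (fun _ _ => norm_nonneg _) fun k hk =>
      norm_blaschke_le (hz k (by simpa using hk)) hx).trans
        (by rw [Finset.prod_const, Finset.card_range])
  have hBpos : 0 ≤ B + n * η * 200 ^ n := by
    have h74 : ‖(7 / 4 : ℂ)‖ = 7 / 4 := by norm_num
    exact add_nonneg ((norm_nonneg _).trans (hB _ h74)) ((norm_nonneg _).trans (hPB _ h74.le))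
  calc ‖g x‖ = ‖(g - P) x + P x‖ := by simp
    _ ≤ ‖(g - P) x‖ + ‖P x‖ := norm_add_le _ _
    _ ≤ _ := add_le_add (hmain.trans (mul_le_mul_of_nonneg_left hprod hBpos))
      (hPB x (hx.trans (by norm_num)))

/-- Interior gradient bound for a harmonic function, expressed through a holomorphic function of
which it is the real part. -/
lemma norm_deriv_le_of_abs_re_le {F : ℂ → ℂ} (hF : DifferentiableOn ℂ F (ball 0 2)) {M : ℝ}
    (hM0 : 0 < M) (hM : ∀ x ∈ ball (0 : ℂ) 2, |(F x).re| ≤ M) {z : ℂ} (hz : ‖z‖ = 7 / 4) :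
    ‖deriv F z‖ ≤ 32 * M := by
  have hsub : ball z (1 / 4) ⊆ ball 0 2 := ball_subset_ball' (by
    rw [dist_zero_right, hz]; norm_num)
  have hz2 : z ∈ ball (0 : ℂ) 2 := hsub (mem_ball_self (by norm_num))
  have hmem : ∀ {w : ℂ}, w ∈ ball (0 : ℂ) (1 / 4) → z + w ∈ ball (0 : ℂ) 2 := fun {w} hw =>
    hsub (by simpa using hw)
  have hG : DifferentiableOn ℂ (fun w => F (z + w) - F z) (ball 0 (1 / 4)) :=
    (hF.comp (by fun_prop) fun w hw => hmem hw).sub_const _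
  have hre : MapsTo (fun w => F (z + w) - F z) (ball 0 (1 / 4)) {x | x.re ≤ 2 * M} := by
    intro w hw
    have h1 := le_of_abs_le (hM _ (hmem hw))
    have h2 := neg_le_of_abs_le (hM z hz2)
    simp only [mem_ofPred_eq, Complex.sub_re]
    linarith
  have hcl : closedBall z (1 / 8) ⊆ ball 0 2 := (closedBall_subset_ball (by norm_num)).trans hsub
  have h := Complex.norm_deriv_le_of_forall_mem_sphere_norm_le (c := z) (R := 1 / 8)
    (C := 4 * M) (f := fun x => F x - F z) (by norm_num) ?_ ?_
  · rw [deriv_sub_const] at h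
    linarith
  · refine DifferentiableOn.diffContOnCl ?_
    rw [closure_ball _ (by norm_num)]
    exact (hF.mono hcl).sub_const _
  · intro y hy
    rw [mem_sphere_iff_norm] at hy
    have := Complex.borelCaratheodory_zero (z := y - z) (by positivity) hG hre (by norm_num)
      (by rw [mem_ball_zero_iff, hy]; norm_num) (by simp)
    simp only [add_sub_cancel, hy] at this
    exact this.trans_eq (by ring)

/-- If `w` coincides locally, up to sign, with `Re F` wherever it does not vanish, and `w` is small
on a disk around a point of positivity, then `F'` is small somewhere in that disk. -/
lemma exists_norm_deriv_le {F : ℂ → ℂ} {w : ℂ → ℝ} {p : ℂ} {h δ : ℝ} (hh : 0 < h)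
    (hF : ∀ x ∈ closedBall p h, DifferentiableAt ℂ F x) (hc : ContinuousOn w (closedBall p h))
    (hw : ∀ x ∈ closedBall p h, w x ≠ 0 →
      ∃ σ : ℝ, |σ| = 1 ∧ w =ᶠ[nhds x] fun y => σ * (F y).re)
    (hδ : ∀ x ∈ closedBall p h, w x ≤ δ) (hp : 0 < w p) :
    ∃ z ∈ closedBall p h, ‖deriv F z‖ ≤ 4 * δ / h := by
  have hpm : p ∈ closedBall p h := mem_closedBall_self hh.le
  have hδ0 : 0 < δ := hp.trans_le (hδ p hpm)
  set lam : ℝ := 2 * δ / h ^ 2 with hlam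
  have hlam0 : 0 < lam := by positivity
  obtain ⟨z, hz, hmax⟩ := (isCompact_closedBall p h).exists_isMaxOn ⟨p, hpm⟩
    (f := fun x => w x - lam * ‖x - p‖ ^ 2) (hc.sub (by fun_prop))
  have hzp := hmax hpm
  simp only [mem_ofPred_eq, sub_self, norm_zero, ne_eq, OfNat.ofNat_ne_zero, not_false_eq_true,
    zero_pow, mul_zero, sub_zero] at hzp
  have hwz : 0 < w z := by
    have : 0 ≤ lam * ‖z - p‖ ^ 2 := by positivity
    linarith
  have hzi : z ∈ ball p h := by
    rw [mem_ball_iff_norm]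
    by_contra! hle
    have h1 : lam * h ^ 2 ≤ lam * ‖z - p‖ ^ 2 := by gcongr
    have h2 : lam * h ^ 2 = 2 * δ := by rw [hlam]; field_simp
    have := hδ z hz
    linarith
  obtain ⟨σ, hσ, hwσ⟩ := hw z hz hwz.ne'
  have hloc : IsLocalMax (fun y => σ * (F y).re - lam * ‖y - p‖ ^ 2) z := by
    filter_upwards [hwσ, isOpen_ball.mem_nhds hzi] with y hy hyb
    rw [← hy, ← hwσ.eq_of_nhds]
    exact hmax (ball_subset_closedBall hyb)
  have hre : HasFDerivAt (fun y => (F y).re) (Complex.reCLM ∘L (deriv F z • (1 : ℂ →L[ℝ] ℂ))) z :=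
    Complex.reCLM.hasFDerivAt.comp z (hF z hz).hasDerivAt.complexToReal_fderiv
  have hsq : HasFDerivAt (fun y : ℂ => ‖y - p‖ ^ 2) (2 • (innerSL ℝ (z - p))) z :=
    ((hasFDerivAt_id z).sub_const p).norm_sq
  have hzero := hloc.hasFDerivAt_eq_zero ((hre.const_mul σ).sub (hsq.const_mul lam))
  have heq : ∀ v : ℂ, σ * (deriv F z * v).re = lam * (2 * inner ℝ (z - p) v) := by
    intro v
    have := DFunLike.congr_fun hzero v
    simp [sub_eq_zero] at this ⊢
    linear_combination this
  refine ⟨z, hz, ?_⟩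
  have h1 := heq ((starRingEnd ℂ) (deriv F z))
  rw [Complex.mul_conj, Complex.ofReal_re, Complex.normSq_eq_norm_sq] at h1
  have h2 : ‖deriv F z‖ ^ 2 ≤ lam * (2 * (h * ‖deriv F z‖)) := by
    have h3 := congrArg abs h1
    rw [abs_mul, hσ, one_mul, abs_of_nonneg (by positivity), abs_mul, abs_mul,
      abs_of_pos hlam0, abs_of_pos (two_pos : (0 : ℝ) < 2)] at h3
    rw [h3]
    gcongr
    refine (abs_real_inner_le_norm _ _).trans ?_
    rw [Complex.norm_conj]
    gcongr
    exact (mem_ball_iff_norm.1 hzi).le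
  have h4 : lam * (2 * h) = 4 * δ / h := by rw [hlam]; field_simp; norm_num
  rcases (norm_nonneg (deriv F z)).eq_or_lt with h0 | h0
  · rw [← h0]; positivity
  · rw [← h4]
    nlinarith

/-- If a nodal function `w = ±u` is small, then the harmonic function `u` itself is small. -/
lemma IsNodal.abs_le_of_le {u w : ℂ → ℝ}
    (hu : InnerProductSpace.HarmonicOnNhd u (ball 0 2)) (hw : IsNodal w (ball 0 2))
    (hsign : ∀ x ∈ ball (0 : ℂ) 2, w x ≠ 0 → ∃ σ : ℝ, |σ| = 1 ∧ w =ᶠ[nhds x] fun y => σ * u y)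
    {M δ : ℝ} (hM0 : 0 < M) (hM : ∀ x ∈ ball (0 : ℂ) 2, |u x| ≤ M)
    (hδ : ∀ x ∈ ball (0 : ℂ) (3 / 2), w x ≤ δ) {p₀ : ℂ} (hp₀ : p₀ ∈ ball (0 : ℂ) 1)
    (hwp₀ : w p₀ ≠ 0) {n : ℕ} (hn : 0 < n) {x : ℂ} (hx : x ∈ ball (0 : ℂ) 1) :
    |u x| ≤ δ + 2 * ((32 * M + n * (64 * n * δ) * 200 ^ n) * (19 / 20) ^ n +
      n * (64 * n * δ) * 200 ^ n) := by
  have hn' : (1 : ℝ) ≤ n := by exact_mod_cast hn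
  have hn0 : (0 : ℝ) < n := by linarith
  have hpos₀ : 0 < w p₀ := lt_of_le_of_ne (hw.nonneg _) hwp₀.symm
  have h12 : ball (0 : ℂ) 1 ⊆ ball 0 2 := ball_subset_ball (by norm_num)
  obtain ⟨F, hF, hFu⟩ := hu.exists_analyticOnNhd_ball_re_eq
  have hFd : ∀ x ∈ ball (0 : ℂ) 2, DifferentiableAt ℂ F x := fun x hx =>
    (hF x hx).differentiableAt
  have hsignF : ∀ x ∈ ball (0 : ℂ) 2, w x ≠ 0 →
      ∃ σ : ℝ, |σ| = 1 ∧ w =ᶠ[nhds x] fun y => σ * (F y).re := by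
    intro x hx h0
    obtain ⟨σ, hσ, he⟩ := hsign x hx h0
    refine ⟨σ, hσ, ?_⟩
    filter_upwards [he, isOpen_ball.mem_nhds hx] with y hy hyb
    rw [hy, ← hFu hyb]
  set h : ℝ := 1 / (16 * n) with hh
  have hh0 : 0 < h := by positivity
  have hh1 : h ≤ 1 / 16 := by
    rw [hh]
    exact one_div_le_one_div_of_le (by norm_num) (by linarith)
  have hex : ∀ k : ℕ, ∃ z : ℂ, k < n →
      |‖z‖ - (1 + k / (4 * n))| ≤ h ∧ ‖deriv F z‖ ≤ 64 * n * δ := by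
    intro k
    by_cases hk : k < n
    swap
    · exact ⟨0, fun hk' => absurd hk' hk⟩
    have hk' : (k : ℝ) / (4 * n) ≤ 1 / 4 := by
      rw [div_le_div_iff₀ (by positivity) (by norm_num)]
      have : (k : ℝ) ≤ n := by exact_mod_cast hk.le
      linarith
    have hk0 : 0 ≤ (k : ℝ) / (4 * n) := by positivity
    obtain ⟨p, hp, hwp⟩ := hw.exists_sphere_ge isOpen_ball (c := 0) (s := 1 + k / (4 * n))
      (by positivity) (closedBall_subset_ball (by linarith)) (x := p₀)
      (closedBall_subset_closedBall (by linarith) (ball_subset_closedBall hp₀))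
    rw [mem_sphere_zero_iff_norm] at hp
    have hsub : closedBall p h ⊆ ball 0 (3 / 2) := closedBall_subset_ball' (by
      rw [dist_zero_right, hp]; linarith)
    have hsub2 := hsub.trans (ball_subset_ball (by norm_num : (3 / 2 : ℝ) ≤ 2))
    obtain ⟨z, hz, hzd⟩ := exists_norm_deriv_le hh0 (fun x hx => hFd x (hsub2 hx))
      (hw.continuousOn.mono hsub2) (fun x hx => hsignF x (hsub2 hx)) (fun x hx => hδ x (hsub hx))
      (hpos₀.trans_le hwp)
    refine ⟨z, fun _ => ⟨?_, hzd.trans_eq ?_⟩⟩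
    · rw [← hp]
      exact (abs_norm_sub_norm_le _ _).trans (mem_closedBall_iff_norm.1 hz)
    · rw [hh]; field_simp; ring
  choose z hz using hex
  have hz43 : ∀ k < n, ‖z k‖ ≤ 4 / 3 := by
    intro k hk
    have hk' : (k : ℝ) / (4 * n) ≤ 1 / 4 := by
      rw [div_le_div_iff₀ (by positivity) (by norm_num)]
      have : (k : ℝ) ≤ n := by exact_mod_cast hk.le
      linarith
    have := le_of_abs_le (hz k hk).1
    linarith
  have hsep : ∀ j < n, ∀ k < n, |(j : ℝ) - k| / (8 * n) ≤ ‖z j - z k‖ := by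
    intro j hj k hk
    rcases eq_or_ne j k with rfl | hjk
    · simp
    refine le_trans ?_ (abs_norm_sub_norm_le _ _)
    have h1 : (1 : ℝ) ≤ |(j : ℝ) - k| := by
      have : (1 : ℤ) ≤ |(j : ℤ) - k| := Int.one_le_abs (sub_ne_zero.2 (by exact_mod_cast hjk))
      exact_mod_cast this
    have h2 : |(j : ℝ) - k| / (8 * n) + 2 * h ≤ |(j : ℝ) / (4 * n) - k / (4 * n)| := by
      rw [← sub_div, abs_div, abs_of_pos (by positivity : (0 : ℝ) < 4 * n), hh]
      rw [← sub_nonneg]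
      have : |(j : ℝ) - k| / (4 * n) - (|(j : ℝ) - k| / (8 * n) + 2 * (1 / (16 * n)))
        = (|(j : ℝ) - k| - 1) / (8 * n) := by field_simp; ring
      rw [this]
      exact div_nonneg (by linarith) (by positivity)
    have h3 := (hz j hj).1
    have h4 := (hz k hk).1
    have h5 : |(j : ℝ) / (4 * n) - k / (4 * n)| ≤ |‖z j‖ - ‖z k‖| + 2 * h := by
      rw [abs_le] at h3 h4
      rw [abs_le]
      have h6 := le_abs_self (‖z j‖ - ‖z k‖)
      have h7 := neg_abs_le (‖z j‖ - ‖z k‖)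
      constructor <;> linarith
    linarith
  have hFd' : DifferentiableOn ℂ F (ball 0 2) := fun x hx => (hFd x hx).differentiableWithinAt
  have hMF : ∀ x ∈ ball (0 : ℂ) 2, |(F x).re| ≤ M := fun x hx => by
    rw [show (F x).re = u x from hFu hx]
    exact hM x hx
  have hgrad : ∀ x ∈ ball (0 : ℂ) 1, ‖deriv F x‖ ≤
      (32 * M + n * (64 * n * δ) * 200 ^ n) * (19 / 20) ^ n + n * (64 * n * δ) * 200 ^ n :=
    fun x hx => norm_le_of_small_at_points hz43 hsep (hFd'.deriv isOpen_ball)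
      (fun y hy => norm_deriv_le_of_abs_re_le hFd' hM0 hMF hy) (fun k hk => (hz k hk).2)
      (by simpa using (mem_ball_zero_iff.1 hx).le)
  have hmv := (convex_ball (0 : ℂ) 1).norm_image_sub_le_of_norm_deriv_le
    (fun x hx => hFd x (h12 hx)) hgrad hp₀ hx
  have hdist : ‖x - p₀‖ ≤ 2 := by
    rw [mem_ball_zero_iff] at hx hp₀
    linarith [norm_sub_le x p₀]
  have hup₀ : |u p₀| ≤ δ := by
    obtain ⟨σ, hσ, he⟩ := hsign p₀ (h12 hp₀) hwp₀
    have h1 := he.eq_of_nhds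
    have h2 : |w p₀| = |u p₀| := by rw [h1, abs_mul, hσ, one_mul]
    rw [← h2, abs_of_pos hpos₀]
    exact hδ _ (ball_subset_ball (by norm_num) hp₀)
  have hre : |u x - u p₀| ≤ ‖F x - F p₀‖ := by
    rw [← hFu (h12 hx), ← hFu (h12 hp₀)]
    exact Complex.abs_re_le_norm (F x - F p₀)
  have hg0 := (norm_nonneg _).trans (hgrad p₀ hp₀)
  have h8 := mul_le_mul_of_nonneg_left hdist hg0
  have h9 := abs_sub_abs_le_abs_sub (u x) (u p₀)
  linarith

/-- Lower bound for the area of the support of a nodal function `w = ±u` in terms of the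
doubling index of the harmonic function `u`. -/
lemma IsNodal.le_area {u w : ℂ → ℝ}
    (hu : InnerProductSpace.HarmonicOnNhd u (ball 0 2)) (hw : IsNodal w (ball 0 2))
    (hsign : ∀ x ∈ ball (0 : ℂ) 2, w x ≠ 0 → ∃ σ : ℝ, |σ| = 1 ∧ w =ᶠ[nhds x] fun y => σ * u y)
    {M m : ℝ} (hm0 : 0 < m) (hmM : m ≤ M) (hM : ∀ x ∈ ball (0 : ℂ) 2, |u x| ≤ M)
    (hm : ∀ b, (∀ x ∈ ball (0 : ℂ) 1, |u x| ≤ b) → m ≤ b) {p₀ : ℂ} (hp₀ : p₀ ∈ ball (0 : ℂ) 1)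
    (hwp₀ : w p₀ ≠ 0) :
    5 / 10 ^ 6 / (Real.log (M / m) + 7) ≤ volume.real ({x | w x ≠ 0} ∩ ball 0 2) := by
  have hM0 : 0 < M := hm0.trans_le hmM
  have hlog0 : 0 ≤ Real.log (M / m) := Real.log_nonneg ((one_le_div hm0).2 hmM)
  set A := volume.real ({x | w x ≠ 0} ∩ ball 0 2) with hA
  have hA0 : 0 < A := by
    refine ENNReal.toReal_pos ?_
      ((measure_mono inter_subset_right).trans_lt measure_ball_lt_top).ne
    exact ((hw.isOpen_ne_zero isOpen_ball subset_rfl).measure_pos volume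
      ⟨p₀, hwp₀, ball_subset_ball (by norm_num) hp₀⟩).ne'
  set n : ℕ := ⌊1 / (6000 * A)⌋₊ with hn
  have hnA : 1 / (6000 * A) < n + 1 := Nat.lt_floor_add_one _
  suffices hN : 3 / 100 * (n : ℝ) - 6 ≤ Real.log (M / m) by
    rw [div_le_iff₀ (by linarith)]
    rw [div_lt_iff₀ (by positivity)] at hnA
    nlinarith
  rcases Nat.eq_zero_or_pos n with h0 | hpos
  · rw [h0, Nat.cast_zero]; linarith
  have hn0 : (0 : ℝ) < n := by exact_mod_cast hpos
  have hnA' : 6 * n * A ≤ 1 / 1000 := by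
    have h1 : (n : ℝ) ≤ 1 / (6000 * A) := Nat.floor_le (by positivity)
    rw [le_div_iff₀ (by positivity)] at h1
    linarith
  have hwu : ∀ x ∈ ball (0 : ℂ) 2, w x ≤ M := by
    intro x hx
    by_cases h0 : w x = 0
    · rw [h0]; exact hM0.le
    · obtain ⟨σ, hσ, he⟩ := hsign x hx h0
      refine (le_abs_self _).trans ?_
      rw [he.eq_of_nhds, abs_mul, hσ, one_mul]
      exact hM x hx
  have hδ : ∀ x ∈ ball (0 : ℂ) (3 / 2), w x ≤ M * (1 / 1000) ^ n := fun x hx =>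
    (hw.le_mul_pow hwu hpos hx).trans (by gcongr)
  set q : ℝ := (19 / 20) ^ n with hq
  have hq0 : 0 < q := by positivity
  have hq1 : q ≤ 1 := pow_le_one₀ (by norm_num) (by norm_num)
  have hδq : M * (1 / 1000) ^ n ≤ M * q := by
    rw [hq]; gcongr M * ?_ ^ n; norm_num
  have hS : n * (64 * n * (M * (1 / 1000) ^ n)) * 200 ^ n ≤ 64 * M * q := by
    have h2 : (n : ℝ) ≤ 2 ^ n := by exact_mod_cast n.lt_two_pow_self.le
    calc (n : ℝ) * (64 * n * (M * (1 / 1000) ^ n)) * 200 ^ n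
        ≤ 2 ^ n * (64 * 2 ^ n * (M * (1 / 1000) ^ n)) * 200 ^ n := by gcongr
      _ = 64 * M * (4 / 5) ^ n := by
        rw [show (4 / 5 : ℝ) = 2 * 2 * (1 / 1000) * 200 by norm_num, mul_pow, mul_pow, mul_pow]
        ring
      _ ≤ 64 * M * q := by rw [hq]; gcongr _ * ?_ ^ n; norm_num
  have hmq : m ≤ 321 * M * q := by
    refine hm _ fun x hx => ?_
    have h1 := hw.abs_le_of_le hu hsign hM0 hM hδ hp₀ hwp₀ hpos hx
    have h2 : (32 * M + n * (64 * n * (M * (1 / 1000) ^ n)) * 200 ^ n) * q ≤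
        (32 * M + 64 * M) * q := by
      have := hS.trans (mul_le_of_le_one_right (by positivity) hq1)
      exact mul_le_mul_of_nonneg_right (by linarith) hq0.le
    linarith
  have hratio : (20 / 19 : ℝ) ^ n / 321 ≤ M / m := by
    rw [div_le_div_iff₀ (by norm_num) hm0]
    have h1 : (20 / 19 : ℝ) ^ n * q = 1 := by rw [hq, ← mul_pow]; norm_num
    calc (20 / 19 : ℝ) ^ n * m ≤ (20 / 19 : ℝ) ^ n * (321 * M * q) := by gcongr
      _ = M * 321 * ((20 / 19 : ℝ) ^ n * q) := by ring
      _ = M * 321 := by rw [h1, mul_one]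
  have hlog := Real.log_le_log (by positivity) hratio
  rw [Real.log_div (by positivity) (by norm_num), Real.log_pow] at hlog
  have h1 : (3 / 100 : ℝ) ≤ Real.log (20 / 19) := by
    have := Real.one_sub_inv_le_log_of_pos (by norm_num : (0 : ℝ) < 20 / 19)
    norm_num at this
    linarith
  have h2 : Real.log 321 ≤ 6 := by
    rw [Real.log_le_iff_le_exp (by norm_num)]
    have h3 := pow_le_pow_left₀ (by norm_num)
      ((by norm_num : (2.7 : ℝ) ≤ 2.7182818283).trans Real.exp_one_gt_d9.le) 6
    rw [← Real.exp_nat_mul] at h3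
    norm_num at h3
    linarith
  nlinarith

open InnerProductSpace in
/-- Harmonicity in terms of `lapl` is harmonicity in the complex plane. -/
lemma harmonicAt_comp_repr {V : Set (EuclideanSpace ℝ (Fin 2))}
    {u : EuclideanSpace ℝ (Fin 2) → ℝ} (hV : IsOpen V) (hu : ContDiffOn ℝ 2 u V)
    (hl : ∀ x ∈ V, lapl 2 u x = 0) {z : ℂ} (hz : Complex.orthonormalBasisOneI.repr z ∈ V) :
    HarmonicAt (u ∘ Complex.orthonormalBasisOneI.repr) z := by
  set e := Complex.orthonormalBasisOneI.repr with he
  refine ⟨(hu.contDiffAt (hV.mem_nhds hz)).comp z e.contDiff.contDiffAt, ?_⟩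
  filter_upwards [(hV.preimage e.continuous).mem_nhds hz] with y hy
  have hd : DifferentiableAt ℝ (fderiv ℝ u) (e y) :=
    ((hu.contDiffAt (hV.mem_nhds hy)).fderiv_right (m := 1) (by norm_num)).differentiableAt
      (by norm_num)
  have hcomp : iteratedFDeriv ℝ 2 (u ∘ e) y =
      (iteratedFDeriv ℝ 2 u (e y)).compContinuousLinearMap fun _ => (e : ℂ →L[ℝ] _) := by
    have := e.toContinuousLinearEquiv.iteratedFDerivWithin_comp_right u uniqueDiffOn_univ
      (x := y) (mem_univ _) 2
    simp only [preimage_univ, iteratedFDerivWithin_univ] at this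
    exact this
  have hlap := hl _ hy
  rw [laplacian_eq_iteratedFDeriv_orthonormalBasis _ Complex.orthonormalBasisOneI,
    Pi.zero_apply, ← hlap, lapl]
  simp only [hcomp]
  refine Finset.sum_congr rfl fun i _ => ?_
  rw [ContinuousMultilinearMap.compContinuousLinearMap_apply, iteratedFDeriv_two_apply,
    fderiv_clm_apply hd (differentiableAt_const _)]
  simp [he, -Complex.coe_orthonormalBasisOneI]

/-- The absolute value of `u` cut off to a nodal domain coincides locally with `±u`. -/
lemma indicator_abs_eventuallyEq {u : ℂ → ℝ} {Ω : Set ℂ} (hΩ : IsOpen Ω)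
    (hc : ContinuousOn u Ω) {x : ℂ} (hx : Ω.indicator (fun y => |u y|) x ≠ 0) :
    ∃ σ : ℝ, |σ| = 1 ∧ Ω.indicator (fun y => |u y|) =ᶠ[nhds x] fun y => σ * u y := by
  have hxΩ : x ∈ Ω := mem_of_indicator_ne_zero hx
  rw [indicator_of_mem hxΩ, abs_ne_zero] at hx
  have hcx := hc.continuousAt (hΩ.mem_nhds hxΩ)
  rcases hx.lt_or_gt with h | h
  · refine ⟨-1, by norm_num, ?_⟩
    filter_upwards [hΩ.mem_nhds hxΩ, hcx.eventually_lt_const h] with y hy hlt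
    rw [indicator_of_mem hy, abs_of_neg hlt, neg_one_mul]
  · refine ⟨1, by norm_num, ?_⟩
    filter_upwards [hΩ.mem_nhds hxΩ, hcx.eventually_const_lt h] with y hy hlt
    rw [indicator_of_mem hy, abs_of_pos hlt, one_mul]

open InnerProductSpace in
/-- The absolute value of a harmonic function cut off to one of its nodal domains is a nodal
function. -/
lemma isNodal_indicator_connectedComponentIn {u : ℂ → ℝ} {U : Set ℂ} (hU : IsOpen U)
    (hu : HarmonicOnNhd u U) (a : ℂ) :
    IsNodal ((connectedComponentIn {x ∈ U | u x ≠ 0} a).indicator fun y => |u y|) U := by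
  set D := {x ∈ U | u x ≠ 0} with hD
  set Ω := connectedComponentIn D a with hΩ
  have hc : ContinuousOn u U := fun x hx => (hu x hx).1.continuousAt.continuousWithinAt
  have hDo : IsOpen D := hc.isOpen_inter_preimage hU isOpen_ne
  have hΩo : IsOpen Ω := hDo.connectedComponentIn
  have hΩU : Ω ⊆ U := (connectedComponentIn_subset D a).trans (sep_subset _ _)
  refine ⟨fun x hx => ContinuousAt.continuousWithinAt ?_,
    fun x => indicator_nonneg (fun _ _ => abs_nonneg _) x, fun x hx hne => ?_⟩
  · have hcx : ContinuousAt (fun y => |u y|) x := (hc.continuousAt (hU.mem_nhds hx)).abs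
    by_cases hxΩ : x ∈ Ω
    · refine hcx.congr ?_
      filter_upwards [hΩo.mem_nhds hxΩ] with y hy
      rw [indicator_of_mem hy]
    by_cases h0 : u x = 0
    · rw [ContinuousAt, indicator_of_notMem hxΩ]
      rw [ContinuousAt, h0, abs_zero] at hcx
      exact squeeze_zero (fun y => indicator_nonneg (fun _ _ => abs_nonneg _) y)
        (fun y => indicator_le_self' (fun _ _ => abs_nonneg _) y) hcx
    · have hxD : x ∈ D := ⟨hx, h0⟩
      refine (continuousAt_const (y := (0 : ℝ))).congr ?_
      filter_upwards [hDo.connectedComponentIn.mem_nhds (mem_connectedComponentIn hxD)] with y hy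
      rw [indicator_of_notMem]
      intro hyΩ
      refine hxΩ ?_
      rw [hΩ, connectedComponentIn_eq hyΩ, ← connectedComponentIn_eq hy]
      exact mem_connectedComponentIn hxD
  · obtain ⟨σ, -, he⟩ := indicator_abs_eventuallyEq hΩo (hc.mono hΩU) hne
    rw [harmonicAt_congr_nhds he]
    exact (hu x hx).const_smul

lemma le_biSup_of_bddAbove_of_nonneg {α : Type*} {f : α → ℝ} {s : Set α} (hf : ∀ x, 0 ≤ f x)
    (hb : BddAbove (f '' s)) {x : α} (hx : x ∈ s) : f x ≤ ⨆ y ∈ s, f y := by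
  obtain ⟨b, hb⟩ := hb
  have hb0 : 0 ≤ b := (hf x).trans (hb ⟨x, hx, rfl⟩)
  have h1 : f x = ⨆ _ : x ∈ s, f x := by rw [ciSup_pos hx]
  rw [h1]
  refine le_ciSup (f := fun y => ⨆ _ : y ∈ s, f y) ⟨b, ?_⟩ x
  rintro _ ⟨y, rfl⟩
  exact Real.iSup_le (fun hy => hb ⟨y, hy, rfl⟩) hb0

/-- Eremenko's lemma, first part: area bound for nodal domains of a planar
harmonic function in terms of its doubling index. -/
theorem stmt_12 :
    ∃ (c C : ℝ), 0 < c ∧ 0 < C ∧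
      ∀ (V : Set (EuclideanSpace ℝ (Fin 2))) (u : EuclideanSpace ℝ (Fin 2) → ℝ),
        IsOpen V → closedBall (0 : EuclideanSpace ℝ (Fin 2)) 2 ⊆ V →
        ContDiffOn ℝ 2 u V →
        (∀ x ∈ V, lapl 2 u x = 0) →
        (∃ x ∈ ball (0 : EuclideanSpace ℝ (Fin 2)) 2, u x ≠ 0) →
        ∀ Ω : Set (EuclideanSpace ℝ (Fin 2)),
          (∃ x ∈ {x ∈ ball (0 : EuclideanSpace ℝ (Fin 2)) 2 | u x ≠ 0},
            Ω = connectedComponentIn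
              {x ∈ ball (0 : EuclideanSpace ℝ (Fin 2)) 2 | u x ≠ 0} x) →
          (Ω ∩ ball (0 : EuclideanSpace ℝ (Fin 2)) 1).Nonempty →
          (volume Ω).toReal ≥
            c / (Real.log ((⨆ x ∈ ball (0 : EuclideanSpace ℝ (Fin 2)) 2, |u x|) /
                  (⨆ x ∈ ball (0 : EuclideanSpace ℝ (Fin 2)) 1, |u x|)) + C) := by
  refine ⟨5 / 10 ^ 6, 7, by norm_num, by norm_num, ?_⟩
  rintro V u hV hVsub hu hl - Ω ⟨a, ha, hΩ⟩ ⟨p, hpΩ, hp1⟩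
  set e := Complex.orthonormalBasisOneI.repr with he
  have hball : ∀ {z : ℂ} {r : ℝ}, z ∈ ball (0 : ℂ) r ↔ e z ∈ ball 0 r := fun {z r} => by
    rw [mem_ball_zero_iff, mem_ball_zero_iff, e.norm_map]
  have hharm : InnerProductSpace.HarmonicOnNhd (u ∘ e) (ball 0 2) := fun z hz =>
    harmonicAt_comp_repr hV hu hl (hVsub (ball_subset_closedBall (hball.1 hz)))
  have hpre : e ⁻¹' Ω = connectedComponentIn {z ∈ ball (0 : ℂ) 2 | (u ∘ e) z ≠ 0} (e.symm a) := by
    have h1 := e.symm.toHomeomorph.image_connectedComponentIn ha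
    have h2 : ∀ s : Set (EuclideanSpace ℝ (Fin 2)), e.symm.toHomeomorph '' s = e ⁻¹' s := fun s =>
      e.symm.toEquiv.image_eq_preimage_symm s
    rw [← hΩ, h2, h2] at h1
    rw [h1]
    congr 1
    ext z
    simp only [mem_preimage, mem_ofPred_eq, hball, Function.comp_apply]
  set Ω' := connectedComponentIn {z ∈ ball (0 : ℂ) 2 | (u ∘ e) z ≠ 0} (e.symm a) with hΩ'
  have hsub : Ω' ⊆ {z ∈ ball (0 : ℂ) 2 | (u ∘ e) z ≠ 0} := connectedComponentIn_subset _ _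
  have hnodal := isNodal_indicator_connectedComponentIn isOpen_ball hharm (e.symm a)
  rw [← hΩ'] at hnodal
  have hsupp : {z | Ω'.indicator (fun y => |(u ∘ e) y|) z ≠ 0} ∩ ball 0 2 = Ω' := by
    ext z
    refine ⟨fun hz => mem_of_indicator_ne_zero hz.1, fun hz => ⟨?_, (hsub hz).1⟩⟩
    rw [mem_ofPred_eq, indicator_of_mem hz]
    exact abs_ne_zero.2 (hsub hz).2
  have hΩo : IsOpen Ω' := by
    have := hnodal.isOpen_ne_zero isOpen_ball subset_rfl
    rwa [hsupp] at this
  have hcont : ContinuousOn (u ∘ e) Ω' := fun z hz =>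
    (hharm z (hsub hz).1).1.continuousAt.continuousWithinAt
  have hvol : volume Ω = volume Ω' := by
    rw [← hpre, e.measurePreserving.measure_preimage_emb
      e.toHomeomorph.measurableEmbedding]
  have hpΩ' : e.symm p ∈ Ω' := by
    rw [← hpre, mem_preimage, e.apply_symm_apply]; exact hpΩ
  have hp1' : e.symm p ∈ ball (0 : ℂ) 1 := by
    rw [hball, e.apply_symm_apply]; exact hp1
  have hbdd : BddAbove ((fun x => |u x|) '' ball 0 2) :=
    ((isCompact_closedBall 0 2).bddAbove_image ((hu.continuousOn.mono hVsub).abs)).mono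
      (image_mono ball_subset_closedBall)
  have h12 : ball (0 : EuclideanSpace ℝ (Fin 2)) 1 ⊆ ball 0 2 := ball_subset_ball (by norm_num)
  have hle2 : ∀ x ∈ ball (0 : EuclideanSpace ℝ (Fin 2)) 2, |u x| ≤ ⨆ x ∈ ball 0 2, |u x| :=
    fun x hx => le_biSup_of_bddAbove_of_nonneg (fun _ => abs_nonneg _) hbdd hx
  have hle1 : ∀ x ∈ ball (0 : EuclideanSpace ℝ (Fin 2)) 1, |u x| ≤ ⨆ x ∈ ball 0 1, |u x| :=
    fun x hx => le_biSup_of_bddAbove_of_nonneg (fun _ => abs_nonneg _)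
      (hbdd.mono (image_mono h12)) hx
  have hsup1 : ∀ b, (∀ x ∈ ball (0 : EuclideanSpace ℝ (Fin 2)) 1, |u x| ≤ b) →
      ⨆ x ∈ ball (0 : EuclideanSpace ℝ (Fin 2)) 1, |u x| ≤ b := fun b hb => by
    have hb0 := (abs_nonneg _).trans (hb p hp1)
    exact Real.iSup_le (fun x => Real.iSup_le (hb x) hb0) hb0
  have hup : u p ≠ 0 := by
    have := (hsub hpΩ').2
    rwa [Function.comp_apply, e.apply_symm_apply] at this
  have hmain := hnodal.le_area hharm (fun x _ => indicator_abs_eventuallyEq hΩo hcont)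
    (lt_of_lt_of_le (abs_pos.2 hup) (hle1 p hp1)) (hsup1 _ fun x hx => hle2 x (h12 hx))
    (fun x hx => hle2 _ (hball.1 hx))
    (fun b hb => hsup1 b fun x hx => by
      have := hb (e.symm x) (by rwa [hball, e.apply_symm_apply])
      rwa [Function.comp_apply, e.apply_symm_apply] at this)
    hp1' (by
      rw [indicator_of_mem hpΩ', Function.comp_apply, e.apply_symm_apply]
      exact abs_ne_zero.2 hup)
  rw [hsupp] at hmain
  rw [hvol]
  exact hmain
end

section
/- There exist constants C₁ > 0 and C₂ > 0 such that the following holds. Let u be harmonic on an open subset of ℝ² containing the closed disk of radius 2 centered at 0, and suppose u is not identically zero on the disk B(0,2). Let N = log( sup_{B(0,2)} |u| / sup_{B(0,1)} |u| ). Then the collection of connected components of {x ∈ B(0,2) : u(x) ≠ 0} that intersect B(0,1) is finite and has cardinality at most C₁·N + C₂. -/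
open MeasureTheory Metric Set

/-- A holomorphic function with many real zeros near the origin is small at the origin. -/
theorem norm_zero_le_mul_pow_card_zeros {R ρ q M : ℝ} (hρ : 0 < ρ) (hR : ρ < R) (hq : 0 ≤ q)
    (S : Finset ℝ) : ∀ H : ℂ → ℂ, DifferentiableOn ℂ H (ball 0 R) → (∀ s ∈ S, |s| ≤ q) →
    q < ρ → (∀ s ∈ S, H s = 0) → (∀ z, ‖z‖ = ρ → ‖H z‖ ≤ M) →
    ‖H 0‖ ≤ M * (q / ρ) ^ S.card := by
  induction S using Finset.induction_on with
  | empty =>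
    intro H hH _ _ _ hM
    simp only [Finset.card_empty, pow_zero, mul_one]
    refine Complex.norm_le_of_forall_mem_frontier_norm_le (U := ball 0 ρ) isBounded_ball
      ?_ ?_ (subset_closure (by simpa using hρ))
    · refine DifferentiableOn.diffContOnCl (hH.mono ?_)
      rw [closure_ball _ hρ.ne']
      exact closedBall_subset_ball hR
    · intro z hz
      rw [frontier_ball _ hρ.ne'] at hz
      exact hM z (by simpa using hz)
  | insert s S hs ih =>
    intro H hH hSq hqρ hS hM
    have hsq : |s| ≤ q := hSq s (by simp)
    have hsR : (s : ℂ) ∈ ball (0 : ℂ) R := by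
      simp only [mem_ball_zero_iff, Complex.norm_real, Real.norm_eq_abs]; linarith
    have hfac : ∀ z, H z = (z - s) * dslope H s z := fun z => by
      have := sub_smul_dslope H (s : ℂ) z
      rw [hS s (by simp), sub_zero, smul_eq_mul] at this
      exact this.symm
    have key := ih (fun z => dslope H s z * ((ρ ^ 2 - s * z) / ρ))
      (((Complex.differentiableOn_dslope (isOpen_ball.mem_nhds hsR)).2 hH).mul (by fun_prop))
      (fun t ht => hSq t (by simp [ht])) hqρ (fun t ht => by
        have h1 := hfac t
        rw [hS t (by simp [ht])] at h1
        have h2 : (t : ℂ) - s ≠ 0 := by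
          rw [sub_ne_zero]
          intro h
          exact hs (Complex.ofReal_injective h ▸ ht)
        have h3 := (mul_eq_zero.1 h1.symm).resolve_left h2
        simp [h3])
      (fun z hz => by
        refine le_trans (le_of_eq ?_) (hM z hz)
        rw [hfac z, norm_mul, norm_mul, mul_comm, norm_div, Complex.norm_real, Real.norm_eq_abs,
          abs_of_pos hρ]
        congr 1
        rw [div_eq_iff hρ.ne', ← sq_eq_sq₀ (norm_nonneg _) (by positivity), mul_pow,
          Complex.sq_norm, Complex.sq_norm, Complex.normSq_apply, Complex.normSq_apply]
        have hz2 : z.re * z.re + z.im * z.im = ρ ^ 2 := by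
          rw [← Complex.normSq_apply, ← Complex.sq_norm, hz]
        have h1 : ((ρ : ℂ) ^ 2 - s * z).re = ρ ^ 2 - s * z.re := by
          simp [← Complex.ofReal_pow]
        have h2 : ((ρ : ℂ) ^ 2 - s * z).im = - (s * z.im) := by
          simp [← Complex.ofReal_pow]
        rw [h1, h2]
        simp only [Complex.sub_re, Complex.sub_im, Complex.ofReal_re, Complex.ofReal_im]
        linear_combination (s ^ 2 - ρ ^ 2) * hz2)
    have h0 : ‖H 0‖ = |s| / ρ * ‖dslope H s 0 * ((ρ ^ 2 - s * 0) / ρ)‖ := by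
      rw [hfac 0]
      simp only [zero_sub, norm_mul, norm_neg, Complex.norm_real, Real.norm_eq_abs, mul_zero,
        sub_zero, norm_div, norm_pow, abs_of_pos hρ]
      field_simp
    rw [h0, Finset.card_insert_of_notMem hs, pow_succ]
    calc |s| / ρ * ‖dslope H s 0 * ((ρ ^ 2 - s * 0) / ρ)‖
        ≤ q / ρ * (M * (q / ρ) ^ S.card) := by gcongr
      _ = _ := by ring

/-- On a horizontal strip, a bounded holomorphic function with many real zeros within
distance `π` of a real point is exponentially small at that point. -/
theorem exists_norm_le_mul_pow_card_zeros_strip {b : ℝ} (hb : 0 < b) :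
    ∃ q : ℝ, 0 < q ∧ q < 1 ∧ ∀ (h : ℂ → ℂ) (M x : ℝ) (S : Finset ℝ),
      DifferentiableOn ℂ h {w | |w.im| < b} → (∀ w : ℂ, |w.im| < b → ‖h w‖ ≤ M) →
      (∀ t ∈ S, |t - x| ≤ Real.pi) → (∀ t ∈ S, h t = 0) → ‖h x‖ ≤ M * q ^ S.card := by
  have hpi := Real.pi_pos
  set a := 2 * b / Real.pi with ha
  have ha0 : 0 < a := by positivity
  set τ : ℝ → ℝ := fun t => (Real.exp (t / a) - 1) / (Real.exp (t / a) + 1) with hτ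
  have hτ' : ∀ t, τ t = 1 - 2 / (Real.exp (t / a) + 1) := fun t => by
    have := Real.exp_pos (t / a)
    simp only [hτ]; field_simp; ring
  have hmono : ∀ t t', t ≤ t' → τ t ≤ τ t' := fun t t' htt => by
    rw [hτ', hτ']; gcongr
  have hodd : ∀ t, τ (-t) = - τ t := fun t => by
    have := Real.exp_pos (t / a)
    simp only [hτ, neg_div, Real.exp_neg]; field_simp; ring
  set q₀ := τ Real.pi with hq₀
  have hq₀pos : 0 < q₀ := by
    have : 1 < Real.exp (Real.pi / a) := Real.one_lt_exp_iff.2 (by positivity)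
    simp only [hq₀, hτ]
    apply div_pos <;> linarith
  have hq₀lt : q₀ < 1 := by
    rw [hq₀, hτ']
    have : 0 < 2 / (Real.exp (Real.pi / a) + 1) := by positivity
    linarith
  refine ⟨q₀ / ((1 + q₀) / 2), by positivity, by rw [div_lt_one] <;> linarith, ?_⟩
  intro h M x S hd hM hS hz
  have hre : ∀ s : ℂ, ‖s‖ < 1 → 0 < ((1 + s) / (1 - s)).re := fun s hs => by
    have h1 : (1 - s) ≠ 0 := by
      intro h0
      have : s = 1 := (sub_eq_zero.1 h0).symm
      simp [this] at hs
    have h2 : 0 < Complex.normSq (1 - s) := Complex.normSq_pos.2 h1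
    have h3 : s.re * s.re + s.im * s.im < 1 := by
      rw [← Complex.normSq_apply, ← Complex.sq_norm]
      nlinarith [norm_nonneg s]
    rw [Complex.div_re, ← add_div]
    apply div_pos _ h2
    simp only [Complex.add_re, Complex.sub_re, Complex.one_re, Complex.add_im, Complex.sub_im,
      Complex.one_im]
    nlinarith
  have him : ∀ s : ℂ, ‖s‖ < 1 → |((x : ℂ) + a * Complex.log ((1 + s) / (1 - s))).im| < b := by
    intro s hs
    have h1 := (Complex.abs_arg_lt_pi_div_two_iff (z := (1 + s) / (1 - s))).2 (Or.inl (hre s hs))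
    simp only [Complex.add_im, Complex.ofReal_im, Complex.mul_im, Complex.ofReal_re,
      Complex.log_im, zero_mul, add_zero, zero_add, abs_mul, abs_of_pos ha0]
    calc a * |((1 + s) / (1 - s)).arg| < a * (Real.pi / 2) := by gcongr
      _ = b := by rw [ha]; field_simp
  have hlog : ∀ t, (1 + (τ t : ℂ)) / (1 - τ t) = (Real.exp (t / a) : ℝ) := fun t => by
    have hE := Real.exp_pos (t / a)
    have : (1 + τ t) / (1 - τ t) = Real.exp (t / a) := by
      have h1 : 1 - τ t = 2 / (Real.exp (t / a) + 1) := by rw [hτ']; ring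
      have h2 : 1 + τ t = 2 * Real.exp (t / a) / (Real.exp (t / a) + 1) := by
        rw [hτ']; field_simp; ring
      rw [h1, h2]; field_simp
    exact_mod_cast this
  have hψ : ∀ t, (x : ℂ) + a * Complex.log ((1 + ((τ (t - x) : ℝ) : ℂ)) / (1 - (τ (t - x) : ℝ)))
      = t := fun t => by
    rw [hlog, ← Complex.ofReal_log (Real.exp_pos _).le, Real.log_exp]
    have : x + a * ((t - x) / a) = t := by field_simp; ring
    exact_mod_cast this
  have hinj : Function.Injective (fun t => τ (t - x)) := fun t t' htt => by
    have h1 := hψ t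
    have h2 := hψ t'
    simp only at htt
    rw [htt, h2] at h1
    exact Complex.ofReal_injective h1.symm
  have key := norm_zero_le_mul_pow_card_zeros (R := 1) (ρ := (1 + q₀) / 2) (q := q₀) (M := M)
    (by positivity) (by linarith) hq₀pos.le (S.image (fun t => τ (t - x)))
    (fun s => h (x + a * Complex.log ((1 + s) / (1 - s)))) ?_ ?_ (by linarith) ?_ ?_
  · rw [Finset.card_image_of_injective _ hinj] at key
    simpa using key
  · refine hd.comp (t := {w | |w.im| < b}) ?_ (fun s hs => him s (by simpa using hs))
    intro s hs
    have hs' : ‖s‖ < 1 := by simpa using hs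
    apply DifferentiableAt.differentiableWithinAt
    have h1 : (1 - s) ≠ 0 := by
      intro h0
      have : s = 1 := (sub_eq_zero.1 h0).symm
      simp [this] at hs'
    have h2 : DifferentiableAt ℂ (fun s : ℂ => (1 + s) / (1 - s)) s :=
      DifferentiableAt.div (by fun_prop) (by fun_prop) h1
    exact ((h2.clog (Or.inl (hre s hs'))).const_mul _).const_add _
  · simp only [Finset.mem_image, forall_exists_index, and_imp, forall_apply_eq_imp_iff₂]
    intro t ht
    have := abs_le.1 (hS t ht)
    rw [abs_le, hq₀, ← hodd]
    exact ⟨hmono _ _ this.1, hmono _ _ this.2⟩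
  · simp only [Finset.mem_image, forall_exists_index, and_imp, forall_apply_eq_imp_iff₂]
    intro t ht
    rw [hψ]
    exact hz t ht
  · intro z hz
    exact hM _ (him z (by rw [hz]; linarith))
/-- Maximum principle for the real part of a holomorphic function. -/
theorem re_le_of_forall_mem_frontier_re_le {f : ℂ → ℂ} {W : Set ℂ} (hW : Bornology.IsBounded W)
    (hf : DiffContOnCl ℂ f W) {m : ℝ} (hm : ∀ z ∈ frontier W, (f z).re ≤ m) {z : ℂ}
    (hz : z ∈ closure W) : (f z).re ≤ m := by
  have h := Complex.norm_le_of_forall_mem_frontier_norm_le (f := fun z => Complex.exp (f z))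
    (C := Real.exp m) hW (Complex.differentiable_exp.comp_diffContOnCl hf)
    (fun z hz => by rw [Complex.norm_exp]; exact Real.exp_le_exp.2 (hm z hz)) hz
  rwa [Complex.norm_exp, Real.exp_le_exp] at h

/-- Maximum principle for the absolute value of the real part of a holomorphic function. -/
theorem abs_re_le_of_forall_mem_frontier_abs_re_le {f : ℂ → ℂ} {W : Set ℂ}
    (hW : Bornology.IsBounded W) (hf : DiffContOnCl ℂ f W) {m : ℝ}
    (hm : ∀ z ∈ frontier W, |(f z).re| ≤ m) {z : ℂ} (hz : z ∈ closure W) : |(f z).re| ≤ m := by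
  refine abs_le'.2 ⟨re_le_of_forall_mem_frontier_re_le hW hf
    (fun z hz => (abs_le'.1 (hm z hz)).1) hz, ?_⟩
  have := re_le_of_forall_mem_frontier_re_le hW hf.neg
    (fun z hz => by simpa using (abs_le'.1 (hm z hz)).2) hz
  simpa using this

open Complex in
/-- The number of zeros on the circle of radius `5 / 4` of a harmonic function on the disk of
radius `2` is controlled by its growth. -/
theorem exists_card_zeros_circle_le : ∃ C₁ C₂ : ℝ, 0 < C₁ ∧ 0 < C₂ ∧
    ∀ (f : ℂ → ℂ) (M m x : ℝ) (S : Finset ℝ), DifferentiableOn ℂ f (ball 0 2) →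
      (∀ z ∈ ball (0 : ℂ) 2, |(f z).re| ≤ M) → 0 < m → m ≤ |(f (circleMap 0 (5 / 4) x)).re| →
      (∀ t ∈ S, |t - x| ≤ Real.pi) → (∀ t ∈ S, (f (circleMap 0 (5 / 4) t)).re = 0) →
      (S.card : ℝ) ≤ C₁ * Real.log (M / m) + C₂ := by
  obtain ⟨q, hq0, hq1, hq⟩ := exists_norm_le_mul_pow_card_zeros_strip (b := 1 / 5) (by norm_num)
  have hlq : 0 < - Real.log q := neg_pos.2 (Real.log_neg hq0 hq1)
  refine ⟨1 / (- Real.log q), Real.log 29 / (- Real.log q), by positivity,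
    div_pos (Real.log_pos (by norm_num)) hlq, ?_⟩
  intro f M m x S hf hM hm hmx hSx hS
  have hmem : ∀ w : ℂ, |w.im| < 1 / 5 → ‖(5 / 4 : ℂ) * exp (w * I)‖ ≤ 7 / 4 := fun w hw => by
    have h1 : Real.exp (-w.im) ≤ Real.exp (1 / 5) :=
      Real.exp_le_exp.2 (by linarith [(abs_lt.1 hw).1])
    have h2 : Real.exp (1 / 5) ≤ 5 / 4 := by
      have := Real.exp_bound_div_one_sub_of_interval (x := 1 / 5) (by norm_num) (by norm_num)
      norm_num at this ⊢
      exact this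
    rw [norm_mul, norm_exp]
    have h3 : (w * I).re = - w.im := by simp
    have h4 : ‖(5 / 4 : ℂ)‖ = 5 / 4 := by norm_num
    rw [h3, h4]
    linarith
  have hcm : ∀ t : ℝ, (5 / 4 : ℂ) * exp (t * I) = circleMap 0 (5 / 4) t := fun t => by
    simp [circleMap]
  have hMpos : 0 < M := by
    refine hm.trans_le (hmx.trans (hM _ ?_))
    rw [← hcm, mem_ball_zero_iff]
    exact (hmem x (by simp)).trans_lt (by norm_num)
  set F : ℂ → ℂ := fun z => f z - (f 0).im * I with hF
  have hFd : DifferentiableOn ℂ F (ball 0 2) := hf.sub_const _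
  have hFre : ∀ z, (F z).re = (f z).re := fun z => by simp [hF]
  have hF0 : ‖F 0‖ ≤ M := by
    have : F 0 = ((f 0).re : ℂ) := by
      simp only [hF, sub_eq_iff_eq_add]; exact (re_add_im _).symm
    rw [this, norm_real]
    exact hM 0 (by simp)
  have hFb : ∀ z : ℂ, ‖z‖ ≤ 7 / 4 → ‖F z‖ ≤ 29 * M := fun z hz => by
    have hz2 : z ∈ ball (0 : ℂ) 2 := by rw [mem_ball_zero_iff]; linarith
    have h := borelCaratheodory hMpos hFd
      (fun z hz => by simpa [hFre] using (le_abs_self _).trans (hM z hz)) two_pos hz2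
    refine h.trans ?_
    have h2 : 0 < 2 - ‖z‖ := by linarith
    rw [← add_div, div_le_iff₀ h2]
    have := norm_nonneg z
    have h3 : ‖F 0‖ * (2 + ‖z‖) ≤ M * (2 + ‖z‖) := by gcongr
    nlinarith
  set g : ℂ → ℂ := fun w => F (5 / 4 * exp (w * I)) with hg
  have hgd : ∀ w : ℂ, |w.im| < 1 / 5 → DifferentiableAt ℂ g w := fun w hw => by
    have : DifferentiableAt ℂ F (5 / 4 * exp (w * I)) :=
      hFd.differentiableAt (isOpen_ball.mem_nhds (by
        rw [mem_ball_zero_iff]; exact (hmem w hw).trans_lt (by norm_num)))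
    exact this.comp w (f := fun w : ℂ => 5 / 4 * exp (w * I)) (by fun_prop)
  have hreal : ∀ t : ℝ, (g + (starRingEnd ℂ) ∘ g ∘ (starRingEnd ℂ)) t =
      ((2 * (f (circleMap 0 (5 / 4) t)).re : ℝ) : ℂ) := fun t => by
    simp only [Pi.add_apply, Function.comp_apply, conj_ofReal, add_conj, hg, hcm, hFre]
  have key := hq (g + (starRingEnd ℂ) ∘ g ∘ (starRingEnd ℂ)) (58 * M) x S
    (fun w hw => (DifferentiableAt.add (hgd w hw) (differentiableAt_conj_conj_iff.2
      (hgd _ (by simpa using hw)))).differentiableWithinAt)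
    (fun w hw => by
      refine (norm_add_le _ _).trans ?_
      have h1 := hFb _ (hmem w hw)
      have h2 := hFb _ (hmem ((starRingEnd ℂ) w) (by simpa using hw))
      simp only [Function.comp_apply, RCLike.norm_conj, hg]
      linarith) hSx
    (fun t ht => by rw [hreal, hS t ht]; simp)
  rw [hreal, norm_real, Real.norm_eq_abs, abs_mul, abs_two] at key
  have h29 : m ≤ 29 * M * q ^ S.card := by linarith
  have hlog := Real.log_le_log hm h29
  rw [Real.log_mul (by positivity) (by positivity), Real.log_mul (by norm_num) hMpos.ne',
    Real.log_pow] at hlog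
  rw [Real.log_div hMpos.ne' hm.ne', one_div_mul_eq_div, ← add_div, le_div_iff₀ hlq]
  linarith

/-- A family of connected components of `U`, each meeting a path, has at most one more member
than the number of times the path leaves `U`. -/
theorem finite_and_ncard_le_of_path {X : Type*} [TopologicalSpace X] {U : Set X} {γ : ℝ → X}
    (hγ : Continuous γ) {I : Set ℝ} (hI : I.OrdConnected) (hfin : {t ∈ I | γ t ∉ U}.Finite)
    {𝒞 : Set (Set X)} (h𝒞 : ∀ Ω ∈ 𝒞, ∃ t ∈ I, γ t ∈ U ∧ Ω = connectedComponentIn U (γ t)) :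
    𝒞.Finite ∧ 𝒞.ncard ≤ {t ∈ I | γ t ∉ U}.ncard + 1 := by
  classical
  choose! θ hθI hθU hθ using h𝒞
  set Z := {t ∈ I | γ t ∉ U} with hZ
  have hmaps : ∀ Ω ∈ 𝒞, (Z ∩ Iio (θ Ω)).ncard ∈ (Finset.range (Z.ncard + 1) : Set ℕ) := by
    intro Ω _
    simpa [Nat.lt_succ_iff] using ncard_le_ncard inter_subset_left hfin
  have haux : ∀ Ω ∈ 𝒞, ∀ Ω' ∈ 𝒞, θ Ω ≤ θ Ω' →
      (Z ∩ Iio (θ Ω)).ncard = (Z ∩ Iio (θ Ω')).ncard → Ω = Ω' := by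
    intro Ω h Ω' h' hle heq
    have hsub : Z ∩ Iio (θ Ω) ⊆ Z ∩ Iio (θ Ω') :=
      inter_subset_inter_right _ (Iio_subset_Iio hle)
    have hEq := eq_of_subset_of_ncard_le hsub heq.ge (hfin.subset inter_subset_left)
    have hU : γ '' Icc (θ Ω) (θ Ω') ⊆ U := by
      rintro _ ⟨t, ht, rfl⟩
      by_contra htU
      have htI : t ∈ I := hI.out (hθI Ω h) (hθI Ω' h') ht
      rcases ht.2.eq_or_lt with rfl | hlt
      · exact htU (hθU Ω' h')
      · have : t ∈ Z ∩ Iio (θ Ω) := hEq ▸ ⟨⟨htI, htU⟩, hlt⟩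
        exact absurd this.2 (not_lt.2 ht.1)
    have hconn : IsPreconnected (γ '' Icc (θ Ω) (θ Ω')) :=
      isPreconnected_Icc.image _ hγ.continuousOn
    have := hconn.subset_connectedComponentIn (mem_image_of_mem γ (left_mem_Icc.2 hle)) hU
      (mem_image_of_mem γ (right_mem_Icc.2 hle))
    rw [hθ Ω h, hθ Ω' h']
    exact connectedComponentIn_eq this
  have hinj : InjOn (fun Ω => (Z ∩ Iio (θ Ω)).ncard) 𝒞 := by
    intro Ω h Ω' h' heq
    rcases le_total (θ Ω) (θ Ω') with hle | hle
    · exact haux Ω h Ω' h' hle heq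
    · exact (haux Ω' h' Ω h hle heq.symm).symm
  refine ⟨Set.Finite.of_injOn hmaps hinj (Finset.finite_toSet _), ?_⟩
  have := ncard_le_ncard_of_injOn _ hmaps hinj (Finset.finite_toSet _)
  rwa [ncard_coe_finset, Finset.card_range] at this

theorem lapl_two_eq_laplacian_comp {u : EuclideanSpace ℝ (Fin 2) → ℝ} {z : ℂ}
    (hu : ContDiffAt ℝ 2 u (Complex.orthonormalBasisOneI.repr z)) :
    Laplacian.laplacian (u ∘ Complex.orthonormalBasisOneI.repr) z =
      lapl 2 u (Complex.orthonormalBasisOneI.repr z) := by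
  have hcomp := Complex.orthonormalBasisOneI.repr.toContinuousLinearEquiv.iteratedFDerivWithin_comp_right
    u (s := univ) uniqueDiffOn_univ (x := z) (mem_univ _) 2
  simp only [preimage_univ, iteratedFDerivWithin_univ] at hcomp
  have hd : DifferentiableAt ℝ (fderiv ℝ u) (Complex.orthonormalBasisOneI.repr z) :=
    (hu.fderiv_right (m := 1) le_rfl).differentiableAt one_ne_zero
  rw [InnerProductSpace.laplacian_eq_iteratedFDeriv_orthonormalBasis _ Complex.orthonormalBasisOneI,
    lapl]
  refine Finset.sum_congr rfl fun j _ => ?_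
  rw [← Complex.orthonormalBasisOneI.repr_self j]
  rw [fderiv_clm_apply hd (by fun_prop)]
  have : iteratedFDeriv ℝ 2 (u ∘ Complex.orthonormalBasisOneI.repr) z =
      (iteratedFDeriv ℝ 2 u (Complex.orthonormalBasisOneI.repr z)).compContinuousLinearMap
        fun _ => (Complex.orthonormalBasisOneI.repr.toContinuousLinearEquiv : ℂ →L[ℝ] _) := hcomp
  rw [this]
  simp [iteratedFDeriv_two_apply]

theorem harmonicOnNhd_comp_repr {V : Set (EuclideanSpace ℝ (Fin 2))}
    {u : EuclideanSpace ℝ (Fin 2) → ℝ} (hV : IsOpen V) (hu : ContDiffOn ℝ 2 u V)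
    (hl : ∀ x ∈ V, lapl 2 u x = 0) :
    InnerProductSpace.HarmonicOnNhd (u ∘ Complex.orthonormalBasisOneI.repr)
      (Complex.orthonormalBasisOneI.repr ⁻¹' V) := by
  intro z hz
  have hu' : ∀ w, Complex.orthonormalBasisOneI.repr w ∈ V →
      ContDiffAt ℝ 2 u (Complex.orthonormalBasisOneI.repr w) :=
    fun w hw => hu.contDiffAt (hV.mem_nhds hw)
  refine ⟨(hu' z hz).comp z Complex.orthonormalBasisOneI.repr.contDiff.contDiffAt, ?_⟩
  filter_upwards [(hV.preimage Complex.orthonormalBasisOneI.repr.continuous).mem_nhds hz]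
    with w hw
  rw [lapl_two_eq_laplacian_comp (hu' w hw), hl _ hw, Pi.zero_apply]

theorem le_biSup_of_forall_le {α : Type*} {s : Set α} {g : α → ℝ} {B : ℝ}
    (hB : ∀ x ∈ s, g x ≤ B) {x : α} (hx : x ∈ s) : g x ≤ ⨆ y ∈ s, g y := by
  have hbdd : BddAbove (range fun y => ⨆ _ : y ∈ s, g y) := by
    refine ⟨max B 0, ?_⟩
    rintro _ ⟨y, rfl⟩
    exact Real.iSup_le (fun hy => (hB y hy).trans (le_max_left _ _)) (le_max_right _ _)
  refine le_ciSup_of_le hbdd x ?_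
  rw [ciSup_pos hx]

/-- The boundary points in an open set `B` of a connected component of `{x ∈ B | u x ≠ 0}` are
zeros of `u`. -/
theorem eq_zero_of_mem_frontier_connectedComponentIn {X : Type*} [TopologicalSpace X]
    [LocallyConnectedSpace X] {B : Set X} {u : X → ℝ} (hU : IsOpen {x ∈ B | u x ≠ 0}) {x y : X}
    (hyB : y ∈ B) (hy : y ∈ frontier (connectedComponentIn {x ∈ B | u x ≠ 0} x)) : u y = 0 := by
  by_contra hne
  have hyU : y ∈ {x ∈ B | u x ≠ 0} := ⟨hyB, hne⟩
  have hyc := mem_connectedComponentIn hyU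
  obtain ⟨w, hwy, hwx⟩ := mem_closure_iff.1 hy.1 _ hU.connectedComponentIn hyc
  have heq := (connectedComponentIn_eq hwx).trans (connectedComponentIn_eq hwy).symm
  refine hy.2 ?_
  rw [hU.connectedComponentIn.interior_eq, heq]
  exact hyc

/-- A nodal domain of a harmonic function on the disk of radius `2` which meets the unit disk
crosses every larger concentric circle. -/
theorem exists_mem_connectedComponentIn_norm_eq {u : EuclideanSpace ℝ (Fin 2) → ℝ} {f : ℂ → ℂ}
    (hf : DifferentiableOn ℂ f (ball 0 2))
    (hfu : ∀ z ∈ ball (0 : ℂ) 2, (f z).re = u (Complex.orthonormalBasisOneI.repr z))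
    (hU : IsOpen {x ∈ ball (0 : EuclideanSpace ℝ (Fin 2)) 2 | u x ≠ 0})
    {x y : EuclideanSpace ℝ (Fin 2)} {r : ℝ} (hr1 : 1 < r) (hr2 : r < 2)
    (hy : y ∈ connectedComponentIn {x ∈ ball (0 : EuclideanSpace ℝ (Fin 2)) 2 | u x ≠ 0} x)
    (hy1 : y ∈ ball (0 : EuclideanSpace ℝ (Fin 2)) 1) :
    ∃ p ∈ connectedComponentIn {x ∈ ball (0 : EuclideanSpace ℝ (Fin 2)) 2 | u x ≠ 0} x,
      ‖p‖ = r := by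
  set U := {x ∈ ball (0 : EuclideanSpace ℝ (Fin 2)) 2 | u x ≠ 0} with hUdef
  set Ω := connectedComponentIn U x with hΩ
  set e := Complex.orthonormalBasisOneI.repr with he
  by_contra! hno
  have hyr : ‖y‖ ≤ r := by
    rw [mem_ball_zero_iff] at hy1; linarith
  have hsub : Ω ⊆ closedBall 0 r := by
    intro p hp
    rw [mem_closedBall_zero_iff]
    by_contra! hpr
    obtain ⟨w, hw, hwr⟩ := isPreconnected_connectedComponentIn.intermediate_value hy hp
      continuous_norm.continuousOn ⟨hyr, hpr.le⟩
    exact hno w hw hwr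
  have hcl : closure Ω ⊆ closedBall 0 r := closure_minimal hsub isClosed_closedBall
  have hcle : closure (e ⁻¹' Ω) ⊆ closedBall 0 r := by
    have : closure (e ⁻¹' Ω) = e ⁻¹' closure Ω := (e.toHomeomorph.preimage_closure Ω).symm
    rw [this]
    intro z hz
    simpa using hcl hz
  have hcle2 : closure (e ⁻¹' Ω) ⊆ ball 0 2 := hcle.trans (closedBall_subset_ball hr2)
  have hzero := abs_re_le_of_forall_mem_frontier_abs_re_le (f := f) (W := e ⁻¹' Ω) (m := 0)
    (isBounded_closedBall.subset (subset_closure.trans hcle))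
    (hf.mono hcle2).diffContOnCl (fun z hz => by
      rw [hfu z (hcle2 hz.1)]
      have hz' : e z ∈ frontier Ω := by
        have := e.toHomeomorph.preimage_frontier Ω
        exact this.symm.subset hz
      have hz2 : e z ∈ ball (0 : EuclideanSpace ℝ (Fin 2)) 2 := by
        simpa using hcle2 hz.1
      rw [eq_zero_of_mem_frontier_connectedComponentIn hU hz2 hz', abs_zero])
    (z := e.symm y) (subset_closure (by simpa using hy))
  have hyU : y ∈ U := connectedComponentIn_subset _ _ hy
  rw [hfu _ (by simpa using hyU.1), e.apply_symm_apply] at hzero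
  exact hyU.2 (abs_nonpos_iff.1 hzero)

/-- Eremenko's lemma, second part: the number of nodal domains of a planar harmonic
function intersecting the unit disk is controlled by the doubling index. -/
theorem stmt_13 :
    ∃ (C₁ C₂ : ℝ), 0 < C₁ ∧ 0 < C₂ ∧
      ∀ (V : Set (EuclideanSpace ℝ (Fin 2))) (u : EuclideanSpace ℝ (Fin 2) → ℝ),
        IsOpen V → closedBall (0 : EuclideanSpace ℝ (Fin 2)) 2 ⊆ V →
        ContDiffOn ℝ 2 u V →
        (∀ x ∈ V, lapl 2 u x = 0) →
        (∃ x ∈ ball (0 : EuclideanSpace ℝ (Fin 2)) 2, u x ≠ 0) →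
        {Ω : Set (EuclideanSpace ℝ (Fin 2)) |
            (∃ x ∈ {x ∈ ball (0 : EuclideanSpace ℝ (Fin 2)) 2 | u x ≠ 0},
              Ω = connectedComponentIn
                {x ∈ ball (0 : EuclideanSpace ℝ (Fin 2)) 2 | u x ≠ 0} x) ∧
            (Ω ∩ ball (0 : EuclideanSpace ℝ (Fin 2)) 1).Nonempty}.Finite ∧
        ({Ω : Set (EuclideanSpace ℝ (Fin 2)) |
            (∃ x ∈ {x ∈ ball (0 : EuclideanSpace ℝ (Fin 2)) 2 | u x ≠ 0},
              Ω = connectedComponentIn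
                {x ∈ ball (0 : EuclideanSpace ℝ (Fin 2)) 2 | u x ≠ 0} x) ∧
            (Ω ∩ ball (0 : EuclideanSpace ℝ (Fin 2)) 1).Nonempty}.ncard : ℝ) ≤
          C₁ * Real.log ((⨆ x ∈ ball (0 : EuclideanSpace ℝ (Fin 2)) 2, |u x|) /
              (⨆ x ∈ ball (0 : EuclideanSpace ℝ (Fin 2)) 1, |u x|)) + C₂ := by
  obtain ⟨C₁, C₂, hC₁, hC₂, hcount⟩ := exists_card_zeros_circle_le
  refine ⟨C₁, C₂ + 1, hC₁, by positivity, ?_⟩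
  intro V u hV hBV hu hl hne
  set U := {x ∈ ball (0 : EuclideanSpace ℝ (Fin 2)) 2 | u x ≠ 0} with hUdef
  set M := ⨆ x ∈ ball (0 : EuclideanSpace ℝ (Fin 2)) 2, |u x| with hMdef
  set m := ⨆ x ∈ ball (0 : EuclideanSpace ℝ (Fin 2)) 1, |u x| with hmdef
  set e := Complex.orthonormalBasisOneI.repr with he
  have hUo : IsOpen U :=
    (hu.continuousOn.mono (ball_subset_closedBall.trans hBV)).isOpen_inter_preimage isOpen_ball
      isOpen_compl_singleton
  have hharm : InnerProductSpace.HarmonicOnNhd (u ∘ e) (ball 0 2) :=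
    (harmonicOnNhd_comp_repr hV hu hl).mono fun z hz =>
      hBV (ball_subset_closedBall (by simpa using hz))
  obtain ⟨f, hfa, hfu⟩ := hharm.exists_analyticOnNhd_ball_re_eq
  replace hfu : ∀ z ∈ ball (0 : ℂ) 2, (f z).re = u (e z) := fun z hz => hfu hz
  have hfd : DifferentiableOn ℂ f (ball 0 2) := hfa.differentiableOn
  obtain ⟨B, hB⟩ := (isCompact_closedBall (0 : EuclideanSpace ℝ (Fin 2)) 2).exists_bound_of_continuousOn
    (hu.continuousOn.mono hBV)
  have hM : ∀ x ∈ ball (0 : EuclideanSpace ℝ (Fin 2)) 2, |u x| ≤ M := fun x hx =>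
    le_biSup_of_forall_le (g := fun x => |u x|) (fun y hy => hB y (ball_subset_closedBall hy)) hx
  have hm : ∀ x ∈ ball (0 : EuclideanSpace ℝ (Fin 2)) 1, |u x| ≤ m := fun x hx =>
    le_biSup_of_forall_le (g := fun x => |u x|) (fun y hy => hB y
      (ball_subset_closedBall (ball_subset_ball one_le_two hy))) hx
  have hmpos : 0 < m := by
    by_contra! hm0
    obtain ⟨x, hx, hux⟩ := hne
    have hana : AnalyticOnNhd ℝ (u ∘ e) (ball 0 2) := fun z hz =>
      HarmonicAt.analyticAt (hharm z hz)
    have hz := hana.eqOn_zero_of_preconnected_of_eventuallyEq_zero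
      (convex_ball 0 2).isPreconnected (z₀ := 0) (by simp) (by
        filter_upwards [ball_mem_nhds (0 : ℂ) one_pos] with z hz
        exact abs_nonpos_iff.1 ((hm (e z) (by simpa using hz)).trans hm0))
    have := hz (x := e.symm x) (by simpa using hx)
    exact hux (by simpa using this)
  have hcirc : ∀ t : ℝ, circleMap 0 (5 / 4) t ∈ ball (0 : ℂ) 2 := fun t => by
    rw [mem_ball_zero_iff, norm_circleMap_zero]; norm_num
  have hrange : ∀ (x : ℝ) (p : ℂ), ‖p‖ = 5 / 4 →
      ∃ t, |t - x| ≤ Real.pi ∧ circleMap 0 (5 / 4) t = p := fun x p hp => by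
    refine ⟨x + (p * Complex.exp (-(x * Complex.I))).arg, ?_, ?_⟩
    · rw [add_sub_cancel_left]; exact Complex.abs_arg_le_pi _
    · have hn : ‖p * Complex.exp (-(x * Complex.I))‖ = 5 / 4 := by
        rw [norm_mul, hp, Complex.norm_exp]; simp
      have h := Complex.norm_mul_exp_arg_mul_I (p * Complex.exp (-(x * Complex.I)))
      rw [hn] at h
      rw [circleMap_zero, Complex.ofReal_add, add_mul, Complex.exp_add, mul_left_comm, h,
        mul_left_comm, ← Complex.exp_add]
      simp
  obtain ⟨z₀, hz₀, hmax⟩ := (isCompact_sphere (0 : ℂ) (5 / 4)).exists_isMaxOn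
    (NormedSpace.sphere_nonempty.2 (by norm_num)) (f := fun z => |(f z).re|)
    ((Complex.continuous_re.comp_continuousOn (hfd.continuousOn.mono
      (sphere_subset_closedBall.trans (closedBall_subset_ball (by norm_num))))).abs)
  obtain ⟨x, -, rfl⟩ := hrange 0 z₀ (by simpa using hz₀)
  have hmx : m ≤ |(f (circleMap 0 (5 / 4) x)).re| := by
    refine Real.iSup_le (fun y => Real.iSup_le (fun hy => ?_) (abs_nonneg _)) (abs_nonneg _)
    have hyn : ‖y‖ < 1 := by simpa using hy
    have h := abs_re_le_of_forall_mem_frontier_abs_re_le (f := f) (W := ball 0 (5 / 4))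
      isBounded_ball (DifferentiableOn.diffContOnCl (hfd.mono (by
        rw [closure_ball _ (by norm_num)]; exact closedBall_subset_ball (by norm_num))))
      (fun z hz => hmax (by rwa [frontier_ball _ (by norm_num)] at hz))
      (z := e.symm y) (subset_closure (by simp; linarith))
    rwa [hfu _ (by simp; linarith), e.apply_symm_apply] at h
  set γ : ℝ → EuclideanSpace ℝ (Fin 2) := fun t => e (circleMap 0 (5 / 4) t) with hγ
  have hγU : ∀ t, γ t ∉ U → (f (circleMap 0 (5 / 4) t)).re = 0 := fun t ht => by
    rw [hfu _ (hcirc t)]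
    by_contra h
    exact ht ⟨mem_ball_zero_iff.2 ((e.norm_map _).trans_lt (mem_ball_zero_iff.1 (hcirc t))), h⟩
  set Z := {t ∈ closedBall x Real.pi | γ t ∉ U} with hZ
  have hK : ∀ S : Finset ℝ, (S : Set ℝ) ⊆ Z → (S.card : ℝ) ≤ C₁ * Real.log (M / m) + C₂ :=
    fun S hS => hcount f M m x S hfd
      (fun z hz => by rw [hfu z hz]; exact hM _ (by simpa using hz)) hmpos hmx
      (fun t ht => by simpa [Real.dist_eq] using (hS ht).1) (fun t ht => hγU t (hS ht).2)
  have hZfin : Z.Finite := by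
    by_contra hinf
    obtain ⟨S, hS, hcard⟩ := Set.Infinite.exists_subset_card_eq hinf
      (⌊C₁ * Real.log (M / m) + C₂⌋₊ + 1)
    have h1 := hK S hS
    rw [hcard] at h1
    push_cast at h1
    linarith [Nat.lt_floor_add_one (C₁ * Real.log (M / m) + C₂)]
  have hZcard : (Z.ncard : ℝ) ≤ C₁ * Real.log (M / m) + C₂ := by
    rw [ncard_eq_toFinset_card _ hZfin]
    exact hK _ (by simp)
  obtain ⟨hfin, hcard⟩ := finite_and_ncard_le_of_path (U := U) (γ := γ) (I := closedBall x Real.pi)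
    (e.continuous.comp (continuous_circleMap 0 (5 / 4)))
    (by rw [Real.closedBall_eq_Icc]; exact ordConnected_Icc) hZfin
    (𝒞 := {Ω | (∃ x ∈ U, Ω = connectedComponentIn U x) ∧
      (Ω ∩ ball (0 : EuclideanSpace ℝ (Fin 2)) 1).Nonempty}) (by
    rintro _ ⟨⟨w, -, rfl⟩, y, hy, hy1⟩
    obtain ⟨p, hp, hpn⟩ := exists_mem_connectedComponentIn_norm_eq hfd hfu hUo
      (r := 5 / 4) (by norm_num) (by norm_num) hy hy1
    obtain ⟨t, ht, htp⟩ := hrange x (e.symm p) (by simpa using hpn)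
    have hγp : γ t = p := by simp only [hγ, htp, e.apply_symm_apply]
    exact ⟨t, by simpa [Real.dist_eq] using ht, hγp ▸ connectedComponentIn_subset _ _ hp,
      hγp ▸ connectedComponentIn_eq hp⟩)
  refine ⟨hfin, ?_⟩
  have : ((ncard _ : ℕ) : ℝ) ≤ ((Z.ncard + 1 : ℕ) : ℝ) := Nat.cast_le.2 hcard
  push_cast at this
  linarith
end
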